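/- If weights are degree-monotone in a generating tuple ⟨μ,d⟩, then the set of trees minimizing the vertex-weighted Wiener index over 𝒯(μ,d) is exactly the set 𝒯ℋ(μ,d) of Huffman trees: Argmin_{T ∈ 𝒯(μ,d)} VWWI(T) = 𝒯ℋ(μ,d). -/

import Mathlib

open scoped Classical
noncomputable section

/-- A directed tree on a finite vertex set `V`: each vertex has an outbound arc to its
`parent`, the `root` is a fixed point of `parent` (i.e. has no genuine outbound arc), and
every vertex reaches the root by iterating `parent`. -/
structure DirTree (V : Type) [Fintype V] [DecidableEq V] where
  root : V
  parent : V → V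
  parent_root : parent root = root
  reaches : ∀ v, ∃ n, parent^[n] v = root

variable {V : Type} [Fintype V] [DecidableEq V]

namespace DirTree

/-- `u` belongs to the subordinate group of `v`: there is a directed path from `u` to `v`. -/
def Desc (T : DirTree V) (u v : V) : Prop := ∃ n, T.parent^[n] u = v

/-- The set of vertices with an arc to `v`. -/
def children (T : DirTree V) (v : V) : Finset V :=
  Finset.univ.filter fun u => T.parent u = v ∧ u ≠ v

/-- Weight `f_T(v)` of the subordinate group of `v`. -/
def f (T : DirTree V) (μ : V → ℝ) (v : V) : ℝ :=
  ∑ u ∈ Finset.univ.filter (fun u => T.Desc u v), μ u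

/-- Degree of `v` in the underlying undirected tree. -/
def deg (T : DirTree V) (v : V) : ℕ :=
  (T.children v).card + (if v = T.root then 0 else 1)

/-- The underlying undirected tree. -/
def toGraph (T : DirTree V) : SimpleGraph V :=
  SimpleGraph.fromRel fun u v => T.parent u = v ∧ u ≠ v

/-- The vector (as a multiset, i.e. up to ascending rearrangement) of subordinate
groups' weights of internal non-root vertices. -/
def fvec (T : DirTree V) (μ : V → ℝ) : Multiset ℝ :=
  (Finset.univ.filter fun m => 1 < T.deg m ∧ m ≠ T.root).val.map (T.f μ)

end DirTree

/-- Degree of a vertex in a simple graph. -/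
def gdeg (G : SimpleGraph V) (v : V) : ℕ :=
  (Finset.univ.filter fun u => G.Adj v u).card

/-- `⟨μ, d⟩` is a generating tuple: nonnegative weights, degrees at least 1 summing to
`2(|V|-1)`, at least two pendent and at least one internal vertex. -/
structure IsGenTuple (μ : V → ℝ) (d : V → ℕ) : Prop where
  nonneg : ∀ v, 0 ≤ μ v
  deg_pos : ∀ v, 1 ≤ d v
  sum_deg : ∑ v, d v = 2 * (Fintype.card V - 1)
  two_le_pendent : 2 ≤ (Finset.univ.filter fun v => d v = 1).card
  one_le_internal : 1 ≤ (Finset.univ.filter fun v => 1 < d v).card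

/-- Weights are degree-monotone in `⟨μ, d⟩`. -/
def DegMonotone (μ : V → ℝ) (d : V → ℕ) : Prop :=
  (∀ m m', 1 < d m → 1 < d m' → d m < d m' → μ m ≤ μ m') ∧
  ∀ v, d v = 1 → 0 < μ v

/-- `T ∈ ℛ(μ,d)`: directed tree with internal root whose (undirected) degrees match `d`. -/
def memR (T : DirTree V) (d : V → ℕ) : Prop :=
  1 < d T.root ∧ ∀ v, T.deg v = d v

/-- `G ∈ 𝒯(μ,d)`: `G` is a tree whose degrees match `d`. -/
def memT (G : SimpleGraph V) (d : V → ℕ) : Prop :=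
  G.IsTree ∧ ∀ v, gdeg G v = d v

/-- Vertex-weighted Wiener index. -/
def VWWI (μ : V → ℝ) (G : SimpleGraph V) : ℝ :=
  (1 / 2) * ∑ u, ∑ v, μ u * μ v * (G.dist u v : ℝ)

/-- `S = (m, L)` is a minimal star for the state `(U, μ, d)`: the center `m` is an
internal vertex of `U` of least degree among internal vertices of least weight, and the
`d m - 1` leaves `L` are pendent vertices of `U` of least weights. -/
def IsMinimalStar (U : Finset V) (μ : V → ℝ) (d : V → ℕ) (m : V) (L : Finset V) : Prop :=
  m ∈ U ∧ 1 < d m ∧ L ⊆ U ∧ m ∉ L ∧ L.card = d m - 1 ∧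
  (∀ v ∈ L, d v = 1) ∧
  (∀ m' ∈ U, 1 < d m' → μ m ≤ μ m') ∧
  (∀ m' ∈ U, 1 < d m' → μ m' = μ m → d m ≤ d m') ∧
  ∀ u ∈ L, ∀ w ∈ U, d w = 1 → w ∉ L → μ u ≤ μ w

/-- Centers used before step `i` (0-indexed). -/
def usedCenters {q : ℕ} (c : Fin q → V) (i : ℕ) : Finset V :=
  (Finset.univ.filter fun j : Fin q => (j : ℕ) < i).image c

/-- Vertex set `V_{i+1}` of the state of the Huffman algorithm before (0-indexed) step `i`,
for the candidate Huffman tree `T` with star centers `c`. -/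
def stateV (T : DirTree V) {q : ℕ} (c : Fin q → V) (i : ℕ) : Finset V :=
  Finset.univ \ (Finset.univ.filter fun j : Fin q => (j : ℕ) < i).biUnion fun j => T.children (c j)

/-- Weight function `μ^{i+1}` of the state before (0-indexed) step `i`. -/
def stateMu (T : DirTree V) (μ : V → ℝ) {q : ℕ} (c : Fin q → V) (i : ℕ) : V → ℝ :=
  fun v => if v ∈ usedCenters c i then T.f μ v else μ v

/-- Degree function `d^{i+1}` of the state before (0-indexed) step `i`. -/
def stateD (d : V → ℕ) {q : ℕ} (c : Fin q → V) (i : ℕ) : V → ℕ :=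
  fun v => if v ∈ usedCenters c i then 1 else d v

/-- `T` is a directed Huffman tree for `⟨μ, d⟩` whose star sequence has centers
`c 0, …, c (q-1)` (so `S_i` has leaf set `children (c i)`): the centers enumerate the
internal vertices, the root is the last center, and at each of the first `q - 1` steps
the corresponding star is a minimal star of the current state. -/
def IsHuffmanSeq (μ : V → ℝ) (d : V → ℕ) (T : DirTree V) {q : ℕ} (c : Fin q → V) : Prop :=
  (∀ v, T.deg v = d v) ∧
  Function.Injective c ∧
  (∀ v, 1 < d v ↔ ∃ j, c j = v) ∧
  (∀ hq : 0 < q, T.root = c ⟨q - 1, Nat.sub_lt hq Nat.one_pos⟩) ∧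
  ∀ i : Fin q, (i : ℕ) < q - 1 →
    IsMinimalStar (stateV T c (i : ℕ)) (stateMu T μ c (i : ℕ)) (stateD d c (i : ℕ))
      (c i) (T.children (c i))

/-- `T ∈ ℛℋ(μ,d)`: `T` is a directed Huffman tree for `⟨μ, d⟩`. -/
def IsHuffmanDir (μ : V → ℝ) (d : V → ℕ) (T : DirTree V) : Prop :=
  ∃ (q : ℕ) (c : Fin q → V), IsHuffmanSeq μ d T c

/-- Sum of the `k` smallest components of a multiset of reals. -/
def ascSum (s : Multiset ℝ) (k : ℕ) : ℝ := ((s.sort (· ≤ ·)).take k).sum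

/-- `x` weakly majorizes `y` (`y ⪯^w x`). -/
def WMaj (x y : Multiset ℝ) : Prop :=
  Multiset.card x = Multiset.card y ∧ ∀ k, ascSum x k ≤ ascSum y k

/-- `x` strictly weakly majorizes `y` (`y ≺^w x`). -/
def SWMaj (x y : Multiset ℝ) : Prop := WMaj x y ∧ x ≠ y

/-- `A` consists of the least elements of the multiset `A + R`. -/
def LeastPart (A R : Multiset ℝ) : Prop := ∀ x ∈ A, ∀ y ∈ R, x ≤ y

theorem exists_leastPart (P : Multiset ℝ) (k : ℕ) (hk : k ≤ P.card) :
    ∃ A R, P = A + R ∧ A.card = k ∧ LeastPart A R := by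
  induction k generalizing P with
  | zero => exact ⟨0, P, by simp, by simp, by simp [LeastPart]⟩
  | succ k ih =>
    have hne : P.toFinset.Nonempty := by
      rw [Multiset.toFinset_nonempty]; rintro rfl; simp at hk
    obtain ⟨x, hx, hmin⟩ := P.toFinset.exists_min_image id hne
    simp only [Multiset.mem_toFinset, id] at hx hmin
    obtain ⟨Q, rfl⟩ := Multiset.exists_cons_of_mem hx
    obtain ⟨A, R, rfl, hA, hAR⟩ := ih Q (by simpa using hk)
    refine ⟨x ::ₘ A, R, by simp, by simp [hA], ?_⟩
    intro a ha y hy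
    rcases Multiset.mem_cons.1 ha with rfl | ha
    · exact hmin y (by simp [hy])
    · exact hAR a ha y hy

theorem sum_lt_sum_of_lt {X Y : Multiset ℝ} (hX : ∀ x ∈ X, 0 < x) (hY : ∀ y ∈ Y, 0 < y)
    (hXY : ∀ x ∈ X, ∀ y ∈ Y, x < y) (hcard : X.card ≤ Y.card) (hne : Y ≠ 0) :
    X.sum < Y.sum := by
  induction X using Multiset.induction_on generalizing Y with
  | empty =>
    obtain ⟨y, hy⟩ := Multiset.exists_mem_of_ne_zero hne
    obtain ⟨Z, rfl⟩ := Multiset.exists_cons_of_mem hy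
    have h1 : 0 < y := hY y hy
    have h2 : 0 ≤ Z.sum := Multiset.sum_nonneg fun z hz => (hY z (by simp [hz])).le
    simp; linarith
  | cons x X ih =>
    obtain ⟨y, hy⟩ := Multiset.exists_mem_of_ne_zero hne
    obtain ⟨Z, rfl⟩ := Multiset.exists_cons_of_mem hy
    have h1 : x < y := hXY x (by simp) y hy
    simp only [Multiset.sum_cons]
    rcases eq_or_ne Z 0 with rfl | hZ
    · have : X = 0 := by simpa using hcard
      subst this; simpa using h1
    · have := ih (Y := Z) (fun a ha => hX a (by simp [ha])) (fun a ha => hY a (by simp [ha]))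
        (fun a ha b hb => hXY a (by simp [ha]) b (by simp [hb])) (by simpa using hcard) hZ
      linarith

theorem LeastPart.eq_or_sum_lt {A R B S : Multiset ℝ} (hA : LeastPart A R) (h : A + R = B + S)
    (hpos : ∀ x ∈ A + R, 0 < x) (hcard : A.card ≤ B.card) : B = A ∨ A.sum < B.sum := by
  have hX : A - B + A ∩ B = A := Multiset.sub_add_inter A B
  have hY : B - A + A ∩ B = B := by
    rw [Multiset.inter_comm]; exact Multiset.sub_add_inter B A
  have hR : ∀ y ∈ B - A, y ∈ R := by
    intro y hy
    have h1 := Multiset.count_pos.2 hy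
    have h2 := congrArg (Multiset.count y) h
    rw [Multiset.count_sub] at h1
    simp only [Multiset.count_add] at h2
    exact Multiset.count_pos.1 (by omega)
  have hlt : ∀ x ∈ A - B, ∀ y ∈ B - A, x < y := by
    intro x hx y hy
    have hxA : x ∈ A := Multiset.mem_of_le (Multiset.sub_le_self A B) hx
    refine lt_of_le_of_ne (hA x hxA y (hR y hy)) ?_
    rintro rfl
    have h1 := Multiset.count_pos.2 hx
    have h2 := Multiset.count_pos.2 hy
    rw [Multiset.count_sub] at h1 h2
    omega
  have hc : (A - B).card ≤ (B - A).card := by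
    have h1 := congrArg Multiset.card hX
    have h2 := congrArg Multiset.card hY
    simp only [Multiset.card_add] at h1 h2
    omega
  rcases eq_or_ne (B - A) 0 with h0 | h0
  · left
    rw [h0] at hc hY
    have h1 : A - B = 0 := by simpa using hc
    rw [h1] at hX
    rw [← hY, hX]
  · right
    have h1 := sum_lt_sum_of_lt (X := A - B) (Y := B - A)
      (fun x hx => hpos x (by
        simp [Multiset.mem_of_le (Multiset.sub_le_self A B) hx]))
      (fun y hy => hpos y (by simp [hR y hy])) hlt hc h0
    have h2 := congrArg Multiset.sum hX
    have h3 := congrArg Multiset.sum hY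
    simp only [Multiset.sum_add] at h2 h3
    linarith

theorem LeastPart.sum_le {A R B S : Multiset ℝ} (hA : LeastPart A R) (h : A + R = B + S)
    (hpos : ∀ x ∈ A + R, 0 < x) (hcard : A.card ≤ B.card) : A.sum ≤ B.sum := by
  rcases hA.eq_or_sum_lt h hpos hcard with h | h
  · rw [h]
  · exact h.le

/-- `MergeSeq P C l`: starting from the weights `P`, one can successively pick pairs
`(w, a)` from `C` and merge `a` of the current weights into a single one, increased by `w`,
so that the merged weights are the members of `l`, in this order. -/
inductive MergeSeq : Multiset ℝ → Multiset (ℝ × ℕ) → List ℝ → Prop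
  | nil (P C) : MergeSeq P C []
  | cons {P A R C C' c z l} : P = A + R → C = c ::ₘ C' → A.card = c.2 → z = c.1 + A.sum →
      MergeSeq (z ::ₘ R) C' l → MergeSeq P C (z :: l)

/-- A `MergeSeq` in which each step uses the least pair and the least weights. -/
inductive GreedySeq : Multiset ℝ → Multiset (ℝ × ℕ) → List ℝ → Prop
  | nil (P C) : GreedySeq P C []
  | cons {P A R C C' c z l} : P = A + R → C = c ::ₘ C' → A.card = c.2 → z = c.1 + A.sum →
      (∀ p ∈ C, c ≤ p) → LeastPart A R →
      GreedySeq (z ::ₘ R) C' l → GreedySeq P C (z :: l)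

theorem GreedySeq.mergeSeq {P C l} (h : GreedySeq P C l) : MergeSeq P C l := by
  induction h with
  | nil => exact .nil _ _
  | cons h1 h2 h3 h4 _ _ _ ih => exact .cons h1 h2 h3 h4 ih

theorem MergeSeq.take {P C l} (h : MergeSeq P C l) (k : ℕ) : MergeSeq P C (l.take k) := by
  induction h generalizing k with
  | nil => simpa using .nil _ _
  | cons h1 h2 h3 h4 _ ih =>
    cases k with
    | zero => simpa using .nil _ _
    | succ k => exact .cons h1 h2 h3 h4 (ih k)

theorem GreedySeq.take {P C l} (h : GreedySeq P C l) (k : ℕ) : GreedySeq P C (l.take k) := by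
  induction h generalizing k with
  | nil => simpa using .nil _ _
  | cons h1 h2 h3 h4 h5 h6 _ ih =>
    cases k with
    | zero => simpa using .nil _ _
    | succ k => exact .cons h1 h2 h3 h4 h5 h6 (ih k)

theorem Multiset.exists_add_of_map_eq_add {α β : Type*} {g : α → β} {Q : Multiset α}
    {A R : Multiset β} (h : Q.map g = A + R) :
    ∃ QA QR, Q = QA + QR ∧ QA.map g = A ∧ QR.map g = R := by
  induction A using Multiset.induction_on generalizing Q with
  | empty => exact ⟨0, Q, by simp, by simp, by simpa using h⟩
  | cons a A ih =>
    rw [Multiset.cons_add] at h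
    obtain ⟨x, hx, rfl, h'⟩ := (Multiset.map_eq_cons g Q (A + R) a).2 h
    obtain ⟨QA, QR, h1, h2, h3⟩ := ih h'
    refine ⟨x ::ₘ QA, QR, ?_, by simp [h2], h3⟩
    rw [Multiset.cons_add, ← h1, Multiset.cons_erase hx]

theorem MergeSeq.perturb {P C l} (h : MergeSeq P C l) (Q : Multiset (ℝ × ℝ))
    (hQ : Q.map Prod.fst = P) :
    ∃ D : ℝ, ∀ t : ℝ, ∃ l', l'.length = l.length ∧ l'.sum = l.sum + t * D ∧
      MergeSeq (Q.map fun p => p.1 + t * p.2) C l' := by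
  induction h generalizing Q with
  | nil => exact ⟨0, fun t => ⟨[], by simp, by simp, .nil _ _⟩⟩
  | @cons P A R C C' c z l h1 h2 h3 h4 _ ih =>
    obtain ⟨QA, QR, rfl, rfl, rfl⟩ := Multiset.exists_add_of_map_eq_add (hQ.trans h1)
    obtain ⟨D, hD⟩ := ih ((z, (QA.map Prod.snd).sum) ::ₘ QR) (by simp)
    refine ⟨(QA.map Prod.snd).sum + D, fun t => ?_⟩
    obtain ⟨l', hl, hs, hm⟩ := hD t
    refine ⟨(z + t * (QA.map Prod.snd).sum) :: l', by simp [hl], by simp [hs]; ring,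
      .cons (Multiset.map_add _ _ _) h2 (by simpa using h3) ?_ (by simpa using hm)⟩
    rw [h4, Multiset.sum_map_add, Multiset.sum_map_mul_left]; ring

/-- Spreading two of the weights apart does not increase the optimal sum. -/
theorem MergeSeq.spread {Q C l x y x' y'} (h : MergeSeq (x ::ₘ y ::ₘ Q) C l)
    (hs : x' + y' = x + y) (hx : x' ≤ x) (hy : x' ≤ y) :
    ∃ l', l'.length = l.length ∧ l'.sum ≤ l.sum ∧ MergeSeq (x' ::ₘ y' ::ₘ Q) C l' := by
  obtain ⟨D, hD⟩ := h.perturb ((x, 1) ::ₘ (y, -1) ::ₘ Q.map fun r => (r, 0)) (by simp)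
  rcases le_total 0 D with h0 | h0
  · obtain ⟨l', h1, h2, h3⟩ := hD (x' - x)
    refine ⟨l', h1, by nlinarith, ?_⟩
    have : y' = y + -(x' - x) := by linarith
    simpa [this] using h3
  · obtain ⟨l', h1, h2, h3⟩ := hD (y - x')
    refine ⟨l', h1, by nlinarith, ?_⟩
    have : y' = x + (y - x') := by linarith
    rw [Multiset.cons_swap]
    simpa [this] using h3

/-- Every two-step merge can be replaced by one starting with a least pair and the least
weights, at no extra cost and with a result at least as spread. -/
theorem exists_greedy_step {A R B S : Multiset ℝ} {p r c e : ℝ × ℕ} {z z₂ : ℝ}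
    (hpos : ∀ x ∈ A + R, 0 < x) (hA : A.card = p.2) (hz : z = p.1 + A.sum)
    (hp : 0 ≤ p.1 ∧ 1 ≤ p.2)
    (hRB : z ::ₘ R = B + S) (hB : B.card = r.2) (hz₂ : z₂ = r.1 + B.sum) (hBS : LeastPart B S)
    (hce : ({p, r} : Multiset (ℝ × ℕ)) = {c, e}) (hle : c ≤ e) (he : 1 ≤ e.2) :
    ∃ A' R' B' S', A + R = A' + R' ∧ A'.card = c.2 ∧ LeastPart A' R' ∧
      (c.1 + A'.sum) ::ₘ R' = B' + S' ∧ B'.card = e.2 ∧ c.1 + A'.sum ≤ z ∧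
      ((S' = S ∧ e.1 + B'.sum = z₂) ∨
       ∃ T, S' = (c.1 + A'.sum) ::ₘ T ∧ S = z ::ₘ T ∧
        (c.1 + A'.sum) + (e.1 + B'.sum) = z + z₂ ∧ c.1 + A'.sum ≤ z₂) := by
  have h1 : p.1 + r.1 = c.1 + e.1 := by
    have := congrArg (fun M => (M.map Prod.fst).sum) hce
    simpa using this
  have h2 : p.2 + r.2 = c.2 + e.2 := by
    have := congrArg (fun M => (M.map Prod.snd).sum) hce
    simpa using this
  have hcp : c ≤ p := by
    have : p ∈ ({c, e} : Multiset (ℝ × ℕ)) := by rw [← hce]; simp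
    simp at this; rcases this with rfl | rfl
    · exact le_rfl
    · exact hle
  have hcr : c ≤ r := by
    have : r ∈ ({c, e} : Multiset (ℝ × ℕ)) := by rw [← hce]; simp
    simp at this; rcases this with rfl | rfl
    · exact le_rfl
    · exact hle
  have hzmem : z ∈ B + S := by rw [← hRB]; simp
  rcases Multiset.mem_add.1 hzmem with hzB | hzS
  · obtain ⟨B₀, rfl⟩ := Multiset.exists_cons_of_mem hzB
    rw [Multiset.cons_add, Multiset.cons_inj_right] at hRB
    subst hRB
    simp only [Multiset.card_cons, Multiset.sum_cons] at hB hz₂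
    obtain ⟨A', E, hE, hA', hAE⟩ := exists_leastPart (A + B₀) c.2 (by simp; omega)
    have hcardE := congrArg Multiset.card hE
    have hsumE := congrArg Multiset.sum hE
    simp only [Multiset.card_add, Multiset.sum_add] at hcardE hsumE
    have hsum : A'.sum ≤ A.sum := hAE.sum_le hE.symm
      (fun x hx => hpos x (by rw [← hE] at hx; simp at hx ⊢; tauto)) (by rw [hA, hA']; exact hcp.2)
    have hS : ∀ x ∈ A + B₀, ∀ y ∈ S, x ≤ y := by
      intro x hx y hy
      rcases Multiset.mem_add.1 hx with hx | hx
      · have h3 : x ≤ A.sum := Multiset.single_le_sum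
          (fun a ha => (hpos a (by simp [ha])).le) x hx
        have h4 := hBS z (by simp) y hy
        linarith [hp.1]
      · exact hBS x (by simp [hx]) y hy
    refine ⟨A', E + S, (c.1 + A'.sum) ::ₘ E, S, by rw [← add_assoc, hE, add_assoc], hA', ?_, by simp,
      by simp; omega, by linarith [hcp.1], Or.inl ⟨rfl, by simp; linarith⟩⟩
    intro x hx y hy
    rcases Multiset.mem_add.1 hy with hy | hy
    · exact hAE x hx y hy
    · exact hS x (by rw [hE]; simp [hx]) y hy
  · obtain ⟨T, rfl⟩ := Multiset.exists_cons_of_mem hzS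
    rw [Multiset.add_cons, Multiset.cons_inj_right] at hRB
    subst hRB
    obtain ⟨A', E, hE, hA', hAE⟩ := exists_leastPart (A + B) c.2 (by simp; omega)
    have hcardE := congrArg Multiset.card hE
    have hsumE := congrArg Multiset.sum hE
    simp only [Multiset.card_add, Multiset.sum_add] at hcardE hsumE
    have hposE : ∀ x ∈ A' + E, 0 < x :=
      fun x hx => hpos x (by rw [← hE] at hx; simp at hx ⊢; tauto)
    have hsum : A'.sum ≤ A.sum := hAE.sum_le hE.symm hposE (by rw [hA, hA']; exact hcp.2)
    have hsum₂ : A'.sum ≤ B.sum := hAE.sum_le (hE.symm.trans (add_comm _ _)) hposE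
      (by rw [hB, hA']; exact hcr.2)
    refine ⟨A', E + T, E, (c.1 + A'.sum) ::ₘ T, by rw [← add_assoc, hE, add_assoc], hA', ?_,
      by simp, by omega, by linarith [hcp.1],
      Or.inr ⟨T, rfl, rfl, by linarith, by linarith [hcr.1]⟩⟩
    intro x hx y hy
    rcases Multiset.mem_add.1 hy with hy | hy
    · exact hAE x hx y hy
    · by_contra! hlt
      obtain ⟨X, hX⟩ := Multiset.exists_cons_of_mem hx
      have h3 : (A' + E).countP (· < x) ≤ X.card := by
        have h5 : E.countP (· < x) = 0 :=
          Multiset.countP_eq_zero.2 fun a ha => not_lt.2 (hAE x hx a ha)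
        have h6 := Multiset.countP_le_card (· < x) X
        rw [Multiset.countP_add, h5, hX, Multiset.countP_cons]
        simpa using h6
      have h4 : B.card ≤ (A + B).countP (· < x) := by
        rw [Multiset.countP_add]
        have : B.countP (· < x) = B.card :=
          Multiset.countP_eq_card.2 fun b hb => lt_of_le_of_lt (hBS b hb y (by simp [hy])) hlt
        omega
      have h7 : A'.card = X.card + 1 := by rw [hX]; simp
      have h8 := hcr.2
      rw [hE] at h4
      omega

/-- The hypotheses on the weights and on the pairs under which merging is studied. -/
structure Regular (P : Multiset ℝ) (C : Multiset (ℝ × ℕ)) : Prop where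
  pos : ∀ x ∈ P, 0 < x
  nonneg : ∀ c ∈ C, 0 ≤ c.1
  one_le : ∀ c ∈ C, 1 ≤ c.2
  chain : ∀ c ∈ C, ∀ e ∈ C, c ≤ e ∨ e ≤ c

theorem Regular.step {A R : Multiset ℝ} {c C'} (h : Regular (A + R) (c ::ₘ C'))
    (hA : A.card = c.2) : Regular ((c.1 + A.sum) ::ₘ R) C' where
  pos x hx := by
    rcases Multiset.mem_cons.1 hx with rfl | hx
    · have h1 := h.nonneg c (by simp)
      have h2 := h.one_le c (by simp)
      have h3 : 0 < A.sum := by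
        have := sum_lt_sum_of_lt (X := 0) (Y := A) (by simp) (fun y hy => h.pos y (by simp [hy]))
          (by simp) (by simp) (by rintro rfl; simp at hA; omega)
        simpa using this
      linarith
    · exact h.pos x (by simp [hx])
  nonneg e he := h.nonneg e (by simp [he])
  one_le e he := h.one_le e (by simp [he])
  chain e he e' he' := h.chain e (by simp [he]) e' (by simp [he'])

theorem Regular.exists_least {P C} (h : Regular P C) (hC : C ≠ 0) : ∃ c ∈ C, ∀ p ∈ C, c ≤ p := by
  obtain ⟨c, hc⟩ := C.toFinset.exists_minimal (by simpa using hC)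
  refine ⟨c, by simpa using hc.1, fun p hp => ?_⟩
  rcases h.chain c (by simpa using hc.1) p hp with h1 | h1
  · exact h1
  · exact hc.2 (by simpa using hp) h1

/-- Greedy merging minimizes the sum of the merged weights. -/
theorem MergeSeq.exists_greedySeq {P C l} (h : MergeSeq P C l) (hr : Regular P C) :
    ∃ g, g.length = l.length ∧ g.sum ≤ l.sum ∧ GreedySeq P C g := by
  induction hn : l.length generalizing P C l with
  | zero => exact ⟨[], by simp, by simp [List.length_eq_zero_iff.1 hn], .nil _ _⟩
  | succ n ih =>
    obtain ⟨z', l', g, hg⟩ : ∃ (z' : ℝ) (l' : List ℝ) (c : ℝ × ℕ), ∃ A R C', P = A + R ∧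
        C = c ::ₘ C' ∧ A.card = c.2 ∧ z' = c.1 + A.sum ∧ (∀ p ∈ C, c ≤ p) ∧ LeastPart A R ∧
        l'.length = n ∧ z' + l'.sum ≤ l.sum ∧ MergeSeq (z' ::ₘ R) C' l' := by
      cases h with
      | nil => simp at hn
      | @cons _ A R _ C' p z l₁ h1 h2 h3 h4 h5 =>
        subst h1 h2
        have hr' := hr.step h3
        rw [← h4] at hr'
        simp only [List.length_cons, Nat.add_right_cancel_iff] at hn
        obtain ⟨g, hgl, hgs, hg⟩ := ih h5 hr' hn
        cases hg with
        | nil =>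
          obtain ⟨c, hc, hmin⟩ := hr.exists_least (by simp)
          have hcp := hmin p (by simp)
          obtain ⟨A', R', hA, hA', hAR⟩ := exists_leastPart (A + R) c.2
            (by have := hcp.2; simp; omega)
          obtain ⟨C'', hC''⟩ := Multiset.exists_cons_of_mem hc
          refine ⟨_, [], c, A', R', C'', hA, hC'', hA', rfl, hmin, hAR, by simpa using hgl, ?_,
            .nil _ _⟩
          have := hAR.sum_le hA.symm (by rw [← hA]; exact hr.pos)
            (by rw [hA', h3]; exact hcp.2)
          simp at hgs ⊢
          linarith [hcp.1]
        | @cons _ B S _ C'' r z₂ g' k1 k2 k3 k4 k5 k6 k7 =>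
          subst k2
          obtain ⟨c, e, hce, hle⟩ : ∃ c e, ({p, r} : Multiset (ℝ × ℕ)) = {c, e} ∧
              ∀ q ∈ p ::ₘ r ::ₘ C'', c ≤ q := by
            rcases hr.chain p (by simp) r (by simp) with h | h
            · refine ⟨p, r, rfl, fun q hq => ?_⟩
              rcases Multiset.mem_cons.1 hq with rfl | hq
              · exact le_rfl
              · exact h.trans (k5 q hq)
            · refine ⟨r, p, Multiset.pair_comm _ _, fun q hq => ?_⟩
              rcases Multiset.mem_cons.1 hq with rfl | hq
              · exact h
              · exact k5 q hq
          have hC : p ::ₘ r ::ₘ C'' = c ::ₘ e ::ₘ C'' := by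
            have := congrArg (· + C'') hce
            simpa using this
          obtain ⟨A', R', B', S', m1, m2, m3, m4, m5, m6, m7⟩ :=
            exists_greedy_step hr.pos h3 h4 ⟨hr.nonneg p (by simp), hr.one_le p (by simp)⟩
              k1 k3 k4 k6 hce (hle e (by rw [hC]; simp)) (hr.one_le e (by rw [hC]; simp))
          obtain ⟨l₂, j1, j2, j3⟩ : ∃ l₂ : List ℝ, l₂.length = g'.length ∧
              (c.1 + A'.sum) + (e.1 + B'.sum) + l₂.sum ≤ z + z₂ + g'.sum ∧
              MergeSeq ((e.1 + B'.sum) ::ₘ S') C'' l₂ := by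
            rcases m7 with ⟨rfl, m8⟩ | ⟨T, rfl, rfl, m8, m9⟩
            · exact ⟨g', rfl, by linarith, by rw [m8]; exact k7.mergeSeq⟩
            · have := k7.mergeSeq
              rw [Multiset.cons_swap] at this
              obtain ⟨l₂, i1, i2, i3⟩ := this.spread m8 m6 m9
              exact ⟨l₂, i1, by linarith, by rw [Multiset.cons_swap]; exact i3⟩
          simp only [List.sum_cons, List.length_cons] at hgs hgl ⊢
          exact ⟨_, (e.1 + B'.sum) :: l₂, c, A', R', e ::ₘ C'', m1, hC, m2, rfl, hle, m3,
            by simp; omega, by simp; linarith, .cons m4 rfl m5 rfl j3⟩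
    obtain ⟨A, R, C', rfl, rfl, k1, k2, k3, k4, k5, k6, k7⟩ := hg
    have hr' := hr.step k1
    rw [← k2] at hr'
    obtain ⟨g', i1, i2, i3⟩ := ih k7 hr' k5
    exact ⟨z' :: g', by simp [i1], by simp; linarith, .cons rfl rfl k1 k2 k3 k4 i3⟩

/-- A merge step with the same outcome as the greedy step is a greedy step. -/
theorem GreedySeq.step_eq {A R : Multiset ℝ} {c C' z l} (h : GreedySeq (A + R) (c ::ₘ C') (z :: l))
    (hr : Regular (A + R) (c ::ₘ C')) (hA : A.card = c.2) (hz : z = c.1 + A.sum) :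
    (∀ p ∈ C', c ≤ p) ∧ LeastPart A R ∧ GreedySeq (z ::ₘ R) C' l := by
  cases h with
  | @cons _ A₀ R₀ _ C₀ c₀ _ _ h1 h2 h3 h4 h5 h6 h7 =>
    have hc := h5 c (by simp)
    have hpos := hr.pos
    rw [h1] at hpos
    have hcard : A₀.card ≤ A.card := by rw [h3, hA]; exact hc.2
    have hAA : A = A₀ := by
      rcases h6.eq_or_sum_lt h1.symm hpos hcard with h | h
      · exact h
      · linarith [hc.1]
    subst hAA
    have hcc : c = c₀ := Prod.ext (by linarith) (by omega)
    subst hcc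
    rw [add_right_inj] at h1
    rw [Multiset.cons_inj_right] at h2
    subst h1 h2
    exact ⟨fun p hp => h5 p (by simp [hp]), h6, h7⟩

theorem GreedySeq.unique {P C l l'} (h : GreedySeq P C l) (h' : GreedySeq P C l')
    (hr : Regular P C) (hl : l.length = l'.length) : l = l' := by
  induction h generalizing l' with
  | nil => simpa [eq_comm] using hl
  | @cons P A R C C' c z l h1 h2 h3 h4 h5 h6 h7 ih =>
    subst h1 h2
    cases h' with
    | nil => simp at hl
    | @cons _ A₀ R₀ _ C₀ c₀ z₀ l₀ k1 k2 k3 k4 k5 k6 k7 =>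
      have hc : c = c₀ := le_antisymm (h5 c₀ (by rw [k2]; simp)) (k5 c (by simp))
      subst hc
      have hz : z₀ = z := by
        rw [k4, h4]
        have hpos := hr.pos
        have e1 := h6.sum_le k1 hpos (by rw [h3, k3])
        have e2 := k6.sum_le k1.symm (by rw [← k1]; exact hpos) (by rw [h3, k3])
        linarith
      subst hz
      obtain ⟨-, -, h8⟩ := (GreedySeq.cons k1 k2 k3 k4 k5 k6 k7).step_eq hr h3 h4
      have hr' := hr.step h3
      rw [← h4] at hr'
      rw [ih h8 hr' (by simpa using hl)]

theorem GreedySeq.pairwise_le {P C l} (h : GreedySeq P C l) (hr : Regular P C) :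
    l.Pairwise (· ≤ ·) := by
  rw [← List.isChain_iff_pairwise]
  induction h with
  | nil => simp
  | @cons P A R C C' c z l h1 h2 h3 h4 h5 h6 h7 ih =>
    subst h1 h2
    have hr' := hr.step h3
    rw [← h4] at hr'
    have ih := ih hr'
    cases h7 with
    | nil => simp
    | @cons _ B S _ C'' e z₂ l₂ k1 k2 k3 k4 k5 k6 k7 =>
      refine List.IsChain.cons_cons ?_ ih
      subst k2
      have hce := h5 e (by simp)
      have hpos := hr'.pos
      have hz : z ∈ B + S := by rw [← k1]; simp
      rcases Multiset.mem_add.1 hz with hz | hz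
      · have : z ≤ B.sum := Multiset.single_le_sum
          (fun x hx => (hpos x (by rw [k1]; simp [hx])).le) z hz
        linarith [hr'.nonneg e (by simp)]
      · obtain ⟨T, rfl⟩ := Multiset.exists_cons_of_mem hz
        rw [Multiset.add_cons, Multiset.cons_inj_right] at k1
        subst k1
        have : A.sum ≤ B.sum := h6.sum_le (S := A + T)
          (by rw [add_left_comm]) hr.pos (by rw [h3, k3]; exact hce.2)
        linarith [hce.1]

theorem GreedySeq.two_mul_le {P C l} (h : GreedySeq P C l) (hr : Regular P C)
    (hC : C.card = l.length + 1) (hP : P.card + C.card = (C.map Prod.snd).sum + 2) :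
    ∀ z ∈ l, 2 * z ≤ P.sum + (C.map Prod.fst).sum := by
  induction h with
  | nil => simp
  | @cons P A R C C' c z l h1 h2 h3 h4 h5 h6 h7 ih =>
    subst h1 h2
    have hr' := hr.step h3
    rw [← h4] at hr'
    simp only [Multiset.card_cons, List.length_cons, Multiset.map_cons, Multiset.sum_cons,
      Multiset.card_add, Multiset.sum_add] at hC hP ih ⊢
    have ih := ih hr' (by omega) (by omega)
    intro x hx
    rcases List.mem_cons.1 hx with rfl | hx
    · obtain ⟨e, he⟩ := Multiset.card_pos_iff_exists_mem.1 (show 0 < C'.card by omega)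
      obtain ⟨C'', rfl⟩ := Multiset.exists_cons_of_mem he
      have hce := h5 e (by simp)
      have h8 : C''.card ≤ (C''.map Prod.snd).sum := by
        have := Multiset.card_nsmul_le_sum (s := C''.map Prod.snd) (a := 1) (by
          intro x hx
          obtain ⟨p, hp, rfl⟩ := Multiset.mem_map.1 hx
          exact hr.one_le p (by simp [hp]))
        simpa using this
      have h9 : 0 ≤ (C''.map Prod.fst).sum := Multiset.sum_nonneg (by
          intro x hx
          obtain ⟨p, hp, rfl⟩ := Multiset.mem_map.1 hx
          exact hr.nonneg p (by simp [hp]))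
      simp only [Multiset.card_cons, Multiset.map_cons, Multiset.sum_cons] at hP ⊢
      have := hce.2
      have h10 : A.sum ≤ R.sum := h6.sum_le (add_comm _ _) hr.pos (by omega)
      linarith [hce.1]
    · have := ih x hx
      linarith

namespace DirTree

variable (T : DirTree V)

/-- Number of arcs on the path from `v` to the root. -/
def depth (v : V) : ℕ := Nat.find (T.reaches v)

theorem iterate_depth (v : V) : T.parent^[T.depth v] v = T.root := Nat.find_spec (T.reaches v)

theorem depth_root : T.depth T.root = 0 := (Nat.find_eq_zero _).2 rfl

theorem depth_eq_zero_iff {v : V} : T.depth v = 0 ↔ v = T.root := by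
  rw [depth, Nat.find_eq_zero]; rfl

theorem depth_eq_succ {v : V} (h : v ≠ T.root) : T.depth v = T.depth (T.parent v) + 1 := by
  have h0 : T.depth v ≠ 0 := fun h' => h (T.depth_eq_zero_iff.1 h')
  apply le_antisymm
  · exact Nat.find_min' _ (by rw [Function.iterate_succ_apply]; exact T.iterate_depth _)
  · obtain ⟨n, hn⟩ := Nat.exists_eq_succ_of_ne_zero h0
    have h1 := T.iterate_depth v
    rw [hn, Nat.succ_eq_add_one, Function.iterate_succ_apply] at h1
    have : T.depth (T.parent v) ≤ n := Nat.find_min' _ h1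
    omega

theorem parent_ne {v : V} (h : v ≠ T.root) : T.parent v ≠ v := by
  intro h'
  have := T.depth_eq_succ h
  rw [h'] at this
  omega

theorem depth_parent (v : V) : T.depth (T.parent v) = T.depth v - 1 := by
  rcases eq_or_ne v T.root with rfl | h
  · rw [T.parent_root, T.depth_root]
  · have := T.depth_eq_succ h
    omega

theorem depth_iterate (n : ℕ) (v : V) : T.depth (T.parent^[n] v) = T.depth v - n := by
  induction n with
  | zero => simp
  | succ n ih => rw [Function.iterate_succ_apply', depth_parent, ih]; omega

variable {T}

theorem Desc.refl (v : V) : T.Desc v v := ⟨0, rfl⟩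

theorem Desc.trans {u v w : V} (h : T.Desc u v) (h' : T.Desc v w) : T.Desc u w := by
  obtain ⟨n, rfl⟩ := h
  obtain ⟨m, rfl⟩ := h'
  exact ⟨m + n, by rw [Function.iterate_add_apply]⟩

theorem desc_parent (v : V) : T.Desc v (T.parent v) := ⟨1, rfl⟩

theorem desc_root (v : V) : T.Desc v T.root := T.reaches v

theorem desc_iff_eq_or {u w : V} : T.Desc u w ↔ w = u ∨ T.Desc (T.parent u) w := by
  constructor
  · rintro ⟨n, rfl⟩
    cases n with
    | zero => exact Or.inl rfl
    | succ n => exact Or.inr ⟨n, rfl⟩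
  · rintro (rfl | h)
    · exact .refl _
    · exact (desc_parent u).trans h

theorem desc_iff_iterate {u w : V} :
    T.Desc u w ↔ T.parent^[T.depth u - T.depth w] u = w := by
  refine ⟨?_, fun h => ⟨_, h⟩⟩
  rintro ⟨n, hn⟩
  have h := T.depth_iterate n u
  rw [hn] at h
  by_cases hle : n ≤ T.depth u
  · rw [show T.depth u - T.depth w = n by omega, hn]
  · have h0 : T.depth w = 0 := by omega
    rw [h0, Nat.sub_zero, T.iterate_depth, T.depth_eq_zero_iff.1 h0]

theorem Desc.depth_le {u w : V} (h : T.Desc u w) : T.depth w ≤ T.depth u := by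
  obtain ⟨n, rfl⟩ := h
  rw [depth_iterate]; omega

theorem Desc.eq_of_depth_le {u w : V} (h : T.Desc u w) (h' : T.depth u ≤ T.depth w) : u = w := by
  rw [desc_iff_iterate, Nat.sub_eq_zero_of_le h'] at h
  exact h

theorem Desc.antisymm {u w : V} (h : T.Desc u w) (h' : T.Desc w u) : u = w :=
  h.eq_of_depth_le h'.depth_le

theorem Desc.eq_of_depth_eq {u w w' : V} (h : T.Desc u w) (h' : T.Desc u w')
    (hd : T.depth w = T.depth w') : w = w' := by
  rw [desc_iff_iterate] at h h'
  rw [← h, ← h', hd]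

theorem not_desc_parent {u : V} (h : u ≠ T.root) : ¬ T.Desc (T.parent u) u :=
  fun h' => T.parent_ne h (h'.antisymm (desc_parent u))

theorem mem_children {u v : V} : u ∈ T.children v ↔ T.parent u = v ∧ u ≠ v := by
  simp [children]

theorem ne_root_of_mem_children {u v : V} (h : u ∈ T.children v) : u ≠ T.root := by
  rintro rfl
  rw [mem_children, T.parent_root] at h
  exact h.2 h.1

theorem mem_children_iff {u v : V} : u ∈ T.children v ↔ T.parent u = v ∧ u ≠ T.root := by
  refine ⟨fun h => ⟨(mem_children.1 h).1, ne_root_of_mem_children h⟩, ?_⟩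
  rintro ⟨rfl, h⟩
  exact mem_children.2 ⟨rfl, (T.parent_ne h).symm⟩

theorem Desc.exists_child {u c : V} (h : T.Desc u c) (hne : u ≠ c) :
    ∃ w ∈ T.children c, T.Desc u w := by
  obtain ⟨n, hn⟩ := h
  induction n generalizing u with
  | zero => exact absurd hn hne
  | succ n ih =>
    rw [Function.iterate_succ_apply] at hn
    by_cases hp : T.parent u = c
    · exact ⟨u, mem_children.2 ⟨hp, hne⟩, .refl u⟩
    · obtain ⟨w, hw, hd⟩ := ih hp hn
      exact ⟨w, hw, (desc_parent u).trans hd⟩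

theorem f_eq_add_sum (μ : V → ℝ) (c : V) : T.f μ c = μ c + ∑ w ∈ T.children c, T.f μ w := by
  have h1 : (Finset.univ.filter fun u => T.Desc u c) =
      insert c ((T.children c).biUnion fun w => Finset.univ.filter fun u => T.Desc u w) := by
    ext u
    simp only [Finset.mem_filter, Finset.mem_univ, true_and, Finset.mem_insert, Finset.mem_biUnion]
    constructor
    · intro h
      by_cases hu : u = c
      · exact Or.inl hu
      · exact Or.inr (h.exists_child hu)
    · rintro (rfl | ⟨w, hw, h⟩)
      · exact .refl _
      · exact h.trans ((mem_children.1 hw).1 ▸ desc_parent w)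
  unfold f
  rw [h1, Finset.sum_insert, Finset.sum_biUnion]
  · intro w hw w' hw' hne
    rw [Function.onFun, Finset.disjoint_left]
    intro u hu hu'
    simp only [Finset.mem_filter, Finset.mem_univ, true_and] at hu hu'
    rw [Finset.mem_coe, mem_children_iff] at hw hw'
    refine hne (hu.eq_of_depth_eq hu' ?_)
    rw [T.depth_eq_succ hw.2, T.depth_eq_succ hw'.2, hw.1, hw'.1]
  · simp only [Finset.mem_biUnion, Finset.mem_filter, Finset.mem_univ, true_and, not_exists,
      not_and]
    intro w hw
    rw [mem_children_iff] at hw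
    rw [← hw.1]
    exact not_desc_parent hw.2

theorem f_mono {μ : V → ℝ} (hμ : ∀ v, 0 ≤ μ v) {u w : V} (h : T.Desc u w) :
    T.f μ u ≤ T.f μ w :=
  Finset.sum_le_sum_of_subset_of_nonneg
    (fun x hx => by simp only [Finset.mem_filter, Finset.mem_univ, true_and] at hx ⊢
                    exact hx.trans h) (fun v _ _ => hμ v)

theorem f_eq_self_of_children_eq_empty (μ : V → ℝ) {v : V} (h : T.children v = ∅) :
    T.f μ v = μ v := by
  rw [f_eq_add_sum, h]; simp

theorem toGraph_adj {u v : V} : T.toGraph.Adj u v ↔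
    (T.parent u = v ∧ u ≠ v) ∨ (T.parent v = u ∧ v ≠ u) := by
  rw [toGraph, SimpleGraph.fromRel_adj]
  constructor
  · rintro ⟨-, h⟩; exact h
  · rintro h; exact ⟨by rcases h with h | h; exacts [h.2, h.2.symm], h⟩

theorem toGraph_adj_parent {u : V} (h : u ≠ T.root) : T.toGraph.Adj u (T.parent u) :=
  toGraph_adj.2 (Or.inl ⟨rfl, (T.parent_ne h).symm⟩)

theorem toGraph_connected : T.toGraph.Connected := by
  have h : ∀ n v, T.depth v = n → T.toGraph.Reachable v T.root := by
    intro n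
    induction n with
    | zero => intro v hv; rw [T.depth_eq_zero_iff.1 hv]
    | succ n ih =>
      intro v hv
      have hr : v ≠ T.root := fun h => by rw [h, T.depth_root] at hv; omega
      exact (toGraph_adj_parent hr).reachable.trans (ih _ (by rw [T.depth_parent, hv]; rfl))
  have : Nonempty V := ⟨T.root⟩
  exact ⟨fun u v => (h _ u rfl).trans (h _ v rfl).symm⟩

variable (T) in
/-- The non-root vertices lying above exactly one of `u` and `v`. -/
def sep (u v : V) : Finset V :=
  Finset.univ.filter fun w => w ≠ T.root ∧ ¬ (T.Desc u w ↔ T.Desc v w)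

theorem mem_sep {u v w : V} : w ∈ T.sep u v ↔ w ≠ T.root ∧ ¬ (T.Desc u w ↔ T.Desc v w) := by
  simp [sep]

theorem sep_comm (u v : V) : T.sep u v = T.sep v u := by
  ext w; rw [mem_sep, mem_sep, iff_comm (a := T.Desc u w)]

theorem sep_parent {u : V} (h : u ≠ T.root) : T.sep u (T.parent u) = {u} := by
  ext w
  rw [mem_sep, Finset.mem_singleton, desc_iff_eq_or]
  constructor
  · tauto
  · rintro rfl
    exact ⟨h, by simp [not_desc_parent h]⟩

theorem card_sep_parent {u v : V} (h : ¬ T.Desc v u) :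
    (T.sep u v).card = (T.sep (T.parent u) v).card + 1 := by
  have hr : u ≠ T.root := by rintro rfl; exact h (desc_root v)
  have hn : u ∉ T.sep (T.parent u) v := by
    rw [mem_sep]; simp [not_desc_parent hr, h]
  rw [← Finset.card_insert_of_notMem hn]
  congr 1
  ext w
  rw [Finset.mem_insert, mem_sep, mem_sep, desc_iff_eq_or (u := u)]
  by_cases hw : w = u
  · subst hw; simp [hr, h]
  · simp [hw]

theorem dist_le_card_sep (u v : V) : T.toGraph.dist u v ≤ (T.sep u v).card := by
  induction hn : (T.sep u v).card generalizing u v with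
  | zero =>
    have h1 : T.Desc v u := by
      by_contra h; have := card_sep_parent h; omega
    have h2 : T.Desc u v := by
      by_contra h; have := card_sep_parent h; rw [sep_comm] at this; omega
    rw [h1.antisymm h2]; simp
  | succ n ih =>
    by_cases h1 : T.Desc v u
    · by_cases h2 : T.Desc u v
      · have := h1.antisymm h2
        subst this; simp [sep] at hn
      · have hr : v ≠ T.root := by rintro rfl; exact h2 (desc_root u)
        have h3 := card_sep_parent h2
        rw [sep_comm, hn] at h3
        have h4 := ih u (T.parent v) (by rw [sep_comm]; omega)
        have h5 := toGraph_connected (T := T) |>.dist_triangle (u := u) (v := T.parent v) (w := v)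
        have h6 := SimpleGraph.dist_eq_one_iff_adj.2 (toGraph_adj_parent hr).symm
        omega
    · have hr : u ≠ T.root := by rintro rfl; exact h1 (desc_root v)
      have h3 := card_sep_parent h1
      have h4 := ih (T.parent u) v (by omega)
      have h5 := toGraph_connected (T := T) |>.dist_triangle (u := u) (v := T.parent u) (w := v)
      have h6 := SimpleGraph.dist_eq_one_iff_adj.2 (toGraph_adj_parent hr)
      omega

theorem card_sep_le_length {u v : V} (p : T.toGraph.Walk u v) : (T.sep u v).card ≤ p.length := by
  induction p with
  | nil => simp [sep]
  | @cons u v w h p ih =>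
    have h1 : T.sep u w ⊆ T.sep u v ∪ T.sep v w := by
      intro x; simp only [Finset.mem_union, mem_sep]; tauto
    have h2 : (T.sep u v).card ≤ 1 := by
      rcases toGraph_adj.1 h with ⟨rfl, h⟩ | ⟨rfl, h⟩
      · rw [sep_parent, Finset.card_singleton]
        rintro rfl; exact h T.parent_root.symm
      · rw [sep_comm, sep_parent, Finset.card_singleton]
        rintro rfl; exact h T.parent_root.symm
    have h3 := Finset.card_le_card h1
    have h4 := Finset.card_union_le (T.sep u v) (T.sep v w)
    simp only [SimpleGraph.Walk.length_cons]
    omega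

theorem dist_eq_card_sep (u v : V) : T.toGraph.dist u v = (T.sep u v).card := by
  obtain ⟨p, hp⟩ := (toGraph_connected (T := T)).exists_walk_length_eq_dist u v
  exact le_antisymm (dist_le_card_sep u v) (hp ▸ card_sep_le_length p)

variable (T) in
/-- Indicator of the relation `Desc`. -/
def ind (u w : V) : ℝ := if T.Desc u w then 1 else 0

theorem f_eq_sum_ind (μ : V → ℝ) (w : V) : T.f μ w = ∑ u, μ u * T.ind u w := by
  simp [f, ind, Finset.sum_filter]

theorem dist_eq_sum_ind (u v : V) : (T.toGraph.dist u v : ℝ) =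
    ∑ w ∈ Finset.univ.erase T.root, (T.ind u w + T.ind v w - 2 * (T.ind u w * T.ind v w)) := by
  have h : T.sep u v = (Finset.univ.erase T.root).filter fun w => ¬ (T.Desc u w ↔ T.Desc v w) := by
    ext w; simp [mem_sep]
  rw [dist_eq_card_sep, h, Finset.card_filter]
  push_cast
  refine Finset.sum_congr rfl fun w _ => ?_
  by_cases h1 : T.Desc u w <;> by_cases h2 : T.Desc v w <;> simp [ind, h1, h2]
  norm_num

theorem VWWI_eq (μ : V → ℝ) : VWWI μ T.toGraph =
    ∑ w ∈ Finset.univ.erase T.root, T.f μ w * (∑ v, μ v - T.f μ w) := by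
  unfold VWWI
  simp_rw [dist_eq_sum_ind, Finset.mul_sum]
  have h : ∀ u : V, ∑ v, ∑ w ∈ Finset.univ.erase T.root,
      1 / 2 * (μ u * μ v * (T.ind u w + T.ind v w - 2 * (T.ind u w * T.ind v w))) =
      ∑ w ∈ Finset.univ.erase T.root, ∑ v,
      1 / 2 * (μ u * μ v * (T.ind u w + T.ind v w - 2 * (T.ind u w * T.ind v w))) :=
    fun u => Finset.sum_comm
  simp_rw [h]
  rw [Finset.sum_comm]
  refine Finset.sum_congr rfl fun w _ => ?_
  have h2 : ∀ u v, 1 / 2 * (μ u * μ v * (T.ind u w + T.ind v w - 2 * (T.ind u w * T.ind v w))) =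
      1 / 2 * ((μ u * T.ind u w) * μ v) + 1 / 2 * (μ u * (μ v * T.ind v w))
       - (μ u * T.ind u w) * (μ v * T.ind v w) := by intros; ring
  simp_rw [h2, Finset.sum_sub_distrib, Finset.sum_add_distrib, ← Finset.mul_sum, ← Finset.sum_mul,
    ← f_eq_sum_ind]
  ring

theorem gdeg_toGraph (v : V) : gdeg T.toGraph v = T.deg v := by
  unfold gdeg deg
  by_cases hv : v = T.root
  · rw [if_pos hv, add_zero]
    congr 1
    ext u
    simp only [Finset.mem_filter, Finset.mem_univ, true_and, toGraph_adj, mem_children]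
    constructor
    · rintro (⟨h, h'⟩ | h)
      · subst hv; rw [T.parent_root] at h; exact absurd h h'
      · exact h
    · exact Or.inr
  · have hn : T.parent v ∉ T.children v := by
      rw [mem_children]
      rintro ⟨h, h'⟩
      have h2 := desc_parent (T := T) (T.parent v)
      rw [h] at h2
      exact not_desc_parent hv h2
    rw [if_neg hv, ← Finset.card_insert_of_notMem hn]
    congr 1
    ext u
    simp only [Finset.mem_filter, Finset.mem_univ, true_and, toGraph_adj, mem_children,
      Finset.mem_insert]
    have := T.parent_ne hv
    constructor
    · rintro (⟨h, h'⟩ | h)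
      · exact Or.inl h.symm
      · exact Or.inr h
    · rintro (rfl | h)
      · exact Or.inl ⟨rfl, this.symm⟩
      · exact Or.inr h

theorem sum_card_children (T : DirTree V) :
    ∑ v, (T.children v).card = Fintype.card V - 1 := by
  rw [← Finset.card_biUnion]
  · rw [← Finset.card_univ, ← Finset.card_erase_of_mem (Finset.mem_univ T.root)]
    congr 1
    ext u
    simp [mem_children_iff]
  · intro v _ w _ hne
    rw [Function.onFun, Finset.disjoint_left]
    intro u hu hu'
    exact hne ((mem_children.1 hu).1.symm.trans (mem_children.1 hu').1)

theorem sum_deg (T : DirTree V) : ∑ v, T.deg v = 2 * (Fintype.card V - 1) := by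
  unfold deg
  rw [Finset.sum_add_distrib, sum_card_children]
  have : ∑ v, (if v = T.root then 0 else 1) = Fintype.card V - 1 := by
    rw [← Finset.card_univ, ← Finset.card_erase_of_mem (Finset.mem_univ T.root),
      Finset.card_eq_sum_ones, ← Finset.sum_erase_add _ _ (Finset.mem_univ T.root)]
    simp only [if_true, add_zero]
    exact Finset.sum_congr rfl fun v hv => by rw [if_neg (Finset.ne_of_mem_erase hv)]
  omega

theorem toGraph_isTree : T.toGraph.IsTree := by
  rw [SimpleGraph.isTree_iff_connected_and_card]
  refine ⟨toGraph_connected, ?_⟩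
  have h1 := T.toGraph.sum_degrees_eq_twice_card_edges
  have h2 : ∀ v, T.toGraph.degree v = T.deg v := by
    intro v
    rw [← gdeg_toGraph, gdeg, ← SimpleGraph.card_neighborFinset_eq_degree]
    congr 1
    ext u
    simp
  simp_rw [h2] at h1
  rw [T.sum_deg] at h1
  have h3 : 0 < Fintype.card V := Fintype.card_pos_iff.2 ⟨T.root⟩
  have h4 : Nat.card T.toGraph.edgeSet = T.toGraph.edgeFinset.card := by
    rw [Nat.card_eq_fintype_card, SimpleGraph.edgeFinset_card]
  rw [h4, Nat.card_eq_fintype_card]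
  omega

theorem exists_toGraph_eq {G : SimpleGraph V} (hG : G.IsTree) (r : V) :
    ∃ T : DirTree V, T.root = r ∧ T.toGraph = G := by
  have hc := hG.connected
  have hex : ∀ v, v ≠ r → ∃ u, G.Adj v u ∧ G.dist u r + 1 = G.dist v r := by
    intro v hv
    obtain ⟨p, hp⟩ := hc.exists_walk_length_eq_dist v r
    cases p with
    | nil => exact absurd rfl hv
    | @cons _ u _ h p =>
      refine ⟨u, h, ?_⟩
      have h1 := SimpleGraph.dist_le p
      have h2 := hc.dist_triangle (u := v) (v := u) (w := r)
      have h3 := SimpleGraph.dist_eq_one_iff_adj.2 h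
      simp only [SimpleGraph.Walk.length_cons] at hp
      omega
  choose! par hadj hdist using hex
  have hreach : ∀ n v, G.dist v r = n → ∃ n, (fun v => if v = r then r else par v)^[n] v = r := by
    intro n
    induction n with
    | zero => intro v hv; exact ⟨0, (hc.dist_eq_zero_iff.1 hv)⟩
    | succ n ih =>
      intro v hv
      have hvr : v ≠ r := by rintro rfl; simp at hv
      have h1 := hdist v hvr
      obtain ⟨m, hm⟩ := ih (par v) (by omega)
      exact ⟨m + 1, by rw [Function.iterate_succ_apply, if_neg hvr]; exact hm⟩
  let T : DirTree V := ⟨r, fun v => if v = r then r else par v, by simp, fun v => hreach _ v rfl⟩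
  refine ⟨T, rfl, ?_⟩
  have hle : T.toGraph ≤ G := by
    have key : ∀ a b, T.parent a = b → a ≠ b → G.Adj a b := by
      intro a b h hne
      have har : a ≠ r := by
        rintro rfl; exact hne (T.parent_root.symm.trans h)
      have : par a = b := by simpa [T, har] using h
      exact this ▸ hadj a har
    intro u v h
    rcases toGraph_adj.1 h with ⟨h, h'⟩ | ⟨h, h'⟩
    · exact key u v h h'
    · exact (key v u h h').symm
  exact le_antisymm hle
    ((SimpleGraph.isTree_iff_minimal_connected.1 hG).le_of_le toGraph_connected hle)

theorem dist_child {c : V} (hc : c ≠ T.root) (hp : T.parent c = T.root) (u : V) :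
    (T.toGraph.dist u c : ℝ) = T.toGraph.dist u T.root + 1 - 2 * T.ind u c := by
  have h1 : ∀ w ∈ Finset.univ.erase T.root, T.ind T.root w = 0 := by
    intro w hw
    have : ¬ T.Desc T.root w := fun h =>
      Finset.ne_of_mem_erase hw (h.antisymm (desc_root w)).symm
    simp [ind, this]
  have h2 : ∀ w ∈ Finset.univ.erase T.root, T.ind c w = if w = c then 1 else 0 := by
    intro w hw
    have : T.Desc c w ↔ w = c := by
      rw [desc_iff_eq_or, hp]
      constructor
      · rintro (h | h)
        · exact h
        · exact absurd (h.antisymm (desc_root w)).symm (Finset.ne_of_mem_erase hw)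
      · exact Or.inl
    simp [ind, this]
  have hcm : c ∈ Finset.univ.erase T.root := by simp [hc]
  rw [dist_eq_sum_ind, dist_eq_sum_ind]
  have h3 : ∀ w ∈ Finset.univ.erase T.root,
      T.ind u w + T.ind c w - 2 * (T.ind u w * T.ind c w) =
      (T.ind u w + T.ind T.root w - 2 * (T.ind u w * T.ind T.root w)) +
        (if w = c then 1 - 2 * T.ind u w else 0) := by
    intro w hw
    rw [h1 w hw, h2 w hw]
    split_ifs <;> ring
  rw [Finset.sum_congr rfl h3, Finset.sum_add_distrib, Finset.sum_ite_eq' , if_pos hcm]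
  ring

/-- A tree with an internal vertex can be rooted at an internal vertex such that no internal
non-root vertex has more than half of the weight below it. -/
theorem exists_centroid {μ : V → ℝ} {d : V → ℕ} (hgen : IsGenTuple μ d) {G : SimpleGraph V}
    (hG : memT G d) : ∃ T : DirTree V, T.toGraph = G ∧ memR T d ∧
      ∀ v, 1 < d v → v ≠ T.root → 2 * T.f μ v ≤ ∑ u, μ u := by
  obtain ⟨m, hm⟩ := Finset.card_pos.1 hgen.one_le_internal
  obtain ⟨r, hr, hmin⟩ := (Finset.univ.filter fun v => 1 < d v).exists_min_image
    (fun r => ∑ u, μ u * (G.dist u r : ℝ)) ⟨m, hm⟩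
  simp only [Finset.mem_filter, Finset.mem_univ, true_and] at hr hmin
  obtain ⟨T, rfl, rfl⟩ := exists_toGraph_eq hG.1 r
  have hdeg : ∀ v, T.deg v = d v := fun v => by rw [← gdeg_toGraph]; exact hG.2 v
  refine ⟨T, rfl, ⟨hr, hdeg⟩, fun v hv hvr => ?_⟩
  obtain ⟨c, hc, hvc⟩ := (desc_root (T := T) v).exists_child hvr
  have hcr := mem_children_iff.1 hc
  have hdc : 1 < d c := by
    by_cases h : v = c
    · exact h ▸ hv
    · obtain ⟨w, hw, -⟩ := hvc.exists_child h
      have := Finset.card_pos.2 ⟨w, hw⟩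
      rw [← hdeg, deg, if_neg hcr.2]
      omega
  have h1 := hmin c hdc
  simp_rw [dist_child hcr.2 hcr.1] at h1
  have h2 : ∀ u, μ u * (T.toGraph.dist u T.root + 1 - 2 * T.ind u c) =
      μ u * T.toGraph.dist u T.root + μ u - 2 * (μ u * T.ind u c) := fun u => by ring
  simp_rw [h2] at h1
  rw [Finset.sum_sub_distrib, Finset.sum_add_distrib, ← Finset.mul_sum, ← f_eq_sum_ind] at h1
  have h3 := f_mono hgen.nonneg hvc
  linarith

end DirTree

theorem sum_mul_ge (n : ℕ) (b s : ℕ → ℝ) (hs : ∀ i, i + 1 < n + 1 → s (i + 1) ≤ s i)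
    (hb : ∀ k ≤ n + 1, 0 ≤ ∑ i ∈ Finset.range k, b i) :
    s n * ∑ i ∈ Finset.range (n + 1), b i ≤ ∑ i ∈ Finset.range (n + 1), b i * s i := by
  induction n with
  | zero => simp [mul_comm]
  | succ n ih =>
    have ih := ih (fun i hi => hs i (by omega)) (fun k hk => hb k (by omega))
    rw [Finset.sum_range_succ, Finset.sum_range_succ (n := n + 1)]
    have h1 := hs n (by omega)
    have h2 := hb (n + 1) (by omega)
    nlinarith

/-- Weak majorization inequality for the concave function `t ↦ t * (M - t)`. -/
theorem sum_mul_sub_le {n : ℕ} {M : ℝ} {x y : ℕ → ℝ}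
    (hx : ∀ i, i + 1 < n → x i ≤ x (i + 1)) (hy : ∀ i, i + 1 < n → y i ≤ y (i + 1))
    (hxM : ∀ i < n, 2 * x i ≤ M) (hyM : ∀ i < n, 2 * y i ≤ M)
    (hxy : ∀ k ≤ n, ∑ i ∈ Finset.range k, x i ≤ ∑ i ∈ Finset.range k, y i) :
    ∑ i ∈ Finset.range n, x i * (M - x i) ≤ ∑ i ∈ Finset.range n, y i * (M - y i) := by
  cases n with
  | zero => simp
  | succ n =>
    have h := sum_mul_ge n (fun i => y i - x i) (fun i => M - x i - y i)
      (fun i hi => by have := hx i hi; have := hy i hi; linarith)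
      (fun k hk => by rw [Finset.sum_sub_distrib]; linarith [hxy k hk])
    have h0 : 0 ≤ (M - x n - y n) * ∑ i ∈ Finset.range (n + 1), (y i - x i) := by
      apply mul_nonneg
      · linarith [hxM n (by omega), hyM n (by omega)]
      · rw [Finset.sum_sub_distrib]; linarith [hxy (n + 1) le_rfl]
    rw [← sub_nonneg, ← Finset.sum_sub_distrib]
    refine (h0.trans h).trans_eq (Finset.sum_congr rfl fun i _ => by ring)

theorem eq_of_sum_mul_sub_le {n : ℕ} {M : ℝ} {x y : ℕ → ℝ}
    (hx : ∀ i, i + 1 < n → x i ≤ x (i + 1)) (hy : ∀ i, i + 1 < n → y i ≤ y (i + 1))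
    (hxM : ∀ i < n, 2 * x i ≤ M) (hyM : ∀ i < n, 2 * y i ≤ M)
    (hxy : ∀ k ≤ n, ∑ i ∈ Finset.range k, x i ≤ ∑ i ∈ Finset.range k, y i)
    (h : ∑ i ∈ Finset.range n, y i * (M - y i) ≤ ∑ i ∈ Finset.range n, x i * (M - x i)) :
    ∀ i < n, x i = y i := by
  have h1 := sum_mul_sub_le (n := n) (M := M) (x := fun i => (x i + y i) / 2) (y := y)
    (fun i hi => by have := hx i hi; have := hy i hi; linarith) hy
    (fun i hi => by have := hxM i hi; have := hyM i hi; linarith) hyM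
    (fun k hk => by
      rw [← Finset.sum_div, Finset.sum_add_distrib]; linarith [hxy k hk])
  have h2 : ∑ i ∈ Finset.range n, (x i + y i) / 2 * (M - (x i + y i) / 2) =
      (∑ i ∈ Finset.range n, x i * (M - x i) + ∑ i ∈ Finset.range n, y i * (M - y i)) / 2 +
      (∑ i ∈ Finset.range n, (x i - y i) ^ 2) / 4 := by
    rw [← Finset.sum_add_distrib, Finset.sum_div, Finset.sum_div, ← Finset.sum_add_distrib]
    exact Finset.sum_congr rfl fun i _ => by ring
  have h3 : ∑ i ∈ Finset.range n, (x i - y i) ^ 2 ≤ 0 := by linarith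
  have h4 := (Finset.sum_eq_zero_iff_of_nonneg (fun i _ => sq_nonneg (x i - y i))).1
    (le_antisymm h3 (Finset.sum_nonneg fun i _ => sq_nonneg _))
  intro i hi
  have := h4 i (by simpa using hi)
  nlinarith [pow_eq_zero_iff (two_ne_zero) |>.1 this]

theorem weights_card_add_card {μ : V → ℝ} {d : V → ℕ} (hgen : IsGenTuple μ d) :
    (Finset.univ.filter fun v => d v = 1).card + (Finset.univ.filter fun v => 1 < d v).card =
      Fintype.card V := by
  rw [← Finset.card_univ, ← Finset.card_filter_add_card_filter_not (s := Finset.univ)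
    (fun v => d v = 1)]
  congr 2
  ext v
  have := hgen.deg_pos v
  simp; omega

/-- The pairs (weight, number of leaves) of the internal vertices outside `U`. -/
def centerPairs (μ : V → ℝ) (d : V → ℕ) (U : Finset V) : Multiset (ℝ × ℕ) :=
  (Finset.univ.filter fun v => 1 < d v ∧ v ∉ U).val.map fun v => (μ v, d v - 1)

/-- The weights of the pendent vertices. -/
def pendentWeights (μ : V → ℝ) (d : V → ℕ) : Multiset ℝ :=
  (Finset.univ.filter fun v => d v = 1).val.map μ

theorem centerPairs_eq_cons (μ : V → ℝ) {d : V → ℕ} {U : Finset V} {c : V} (hc : 1 < d c)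
    (hU : c ∉ U) : centerPairs μ d U = (μ c, d c - 1) ::ₘ centerPairs μ d (insert c U) := by
  have h : (Finset.univ.filter fun v => 1 < d v ∧ v ∉ U) =
      insert c (Finset.univ.filter fun v => 1 < d v ∧ v ∉ insert c U) := by
    ext v
    simp only [Finset.mem_filter, Finset.mem_univ, true_and, Finset.mem_insert]
    by_cases hv : v = c
    · subst hv; simp [hc, hU]
    · simp [hv]
  rw [centerPairs, h, Finset.insert_val_of_notMem (by simp), Multiset.map_cons]
  rfl

theorem regular_initial {μ : V → ℝ} {d : V → ℕ} (hgen : IsGenTuple μ d) (hmono : DegMonotone μ d) :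
    Regular (pendentWeights μ d) (centerPairs μ d ∅) where
  pos x hx := by
    obtain ⟨v, hv, rfl⟩ := Multiset.mem_map.1 hx
    exact hmono.2 v (by simpa using hv)
  nonneg c hc := by
    obtain ⟨v, hv, rfl⟩ := Multiset.mem_map.1 hc
    exact hgen.nonneg v
  one_le c hc := by
    obtain ⟨v, hv, rfl⟩ := Multiset.mem_map.1 hc
    simp at hv ⊢; omega
  chain c hc e he := by
    obtain ⟨v, hv, rfl⟩ := Multiset.mem_map.1 hc
    obtain ⟨w, hw, rfl⟩ := Multiset.mem_map.1 he
    simp only [Finset.mem_val, Finset.mem_filter, Finset.mem_univ, true_and] at hv hw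
    rcases lt_trichotomy (d v) (d w) with h | h | h
    · exact Or.inl ⟨hmono.1 v w hv.1 hw.1 h, by simp; omega⟩
    · rcases le_total (μ v) (μ w) with h' | h'
      · exact Or.inl ⟨h', by simp; omega⟩
      · exact Or.inr ⟨h', by simp; omega⟩
    · exact Or.inr ⟨hmono.1 w v hw.1 hv.1 h, by simp; omega⟩

theorem card_initial {μ : V → ℝ} {d : V → ℕ} (hgen : IsGenTuple μ d) :
    (pendentWeights μ d).card + (centerPairs μ d ∅).card =
      ((centerPairs μ d ∅).map Prod.snd).sum + 2 := by
  have h0 := weights_card_add_card hgen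
  have h1 := hgen.sum_deg
  have h2 := hgen.two_le_pendent
  rw [← Finset.sum_filter_add_sum_filter_not (s := Finset.univ) (fun v => d v = 1)] at h1
  have h3 : ∑ v ∈ Finset.univ.filter (fun v => d v = 1), d v =
      (Finset.univ.filter fun v => d v = 1).card := by
    rw [Finset.card_eq_sum_ones]
    exact Finset.sum_congr rfl fun v hv => by simpa using hv
  have h4 : (Finset.univ.filter fun v => ¬ d v = 1) = Finset.univ.filter fun v => 1 < d v := by
    ext v
    have := hgen.deg_pos v
    simp; omega
  have h5 : ∑ v ∈ Finset.univ.filter (fun v => 1 < d v), d v =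
      ∑ v ∈ Finset.univ.filter (fun v => 1 < d v), (d v - 1) +
      (Finset.univ.filter fun v => 1 < d v).card := by
    rw [Finset.card_eq_sum_ones, ← Finset.sum_add_distrib]
    refine Finset.sum_congr rfl fun v hv => ?_
    simp at hv; omega
  rw [h3, h4, h5] at h1
  simp only [pendentWeights, centerPairs, Multiset.card_map, Multiset.map_map, Finset.card_val,
    Finset.notMem_empty, not_false_eq_true, and_true, Function.comp_def]
  change _ = ∑ v ∈ Finset.univ.filter (fun v => 1 < d v), (d v - 1) + 2
  omega

theorem sum_initial {μ : V → ℝ} {d : V → ℕ} (hgen : IsGenTuple μ d) :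
    (pendentWeights μ d).sum + ((centerPairs μ d ∅).map Prod.fst).sum = ∑ v, μ v := by
  rw [← Finset.sum_filter_add_sum_filter_not (s := Finset.univ) (fun v => d v = 1)]
  have h4 : (Finset.univ.filter fun v => ¬ d v = 1) = Finset.univ.filter fun v => 1 < d v := by
    ext v
    have := hgen.deg_pos v
    simp; omega
  rw [h4]
  simp only [pendentWeights, centerPairs, Multiset.map_map,
    Finset.notMem_empty, not_false_eq_true, and_true, Function.comp_def]
  rfl

theorem card_centerPairs_empty (μ : V → ℝ) (d : V → ℕ) :
    (centerPairs μ d ∅).card = (Finset.univ.filter fun v => 1 < d v).card := by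
  simp [centerPairs]
  rfl

/-- The first `i` members of a sequence. -/
def initialSeg (t : ℕ → V) (i : ℕ) : Finset V := (Finset.range i).image t

theorem mem_initialSeg {t : ℕ → V} {i : ℕ} {v : V} : v ∈ initialSeg t i ↔ ∃ j < i, t j = v := by
  simp [initialSeg]

theorem initialSeg_succ (t : ℕ → V) (i : ℕ) :
    initialSeg t (i + 1) = insert (t i) (initialSeg t i) := by
  simp [initialSeg, Finset.range_add_one, Finset.image_insert]

/-- `t 0, …, t (N - 1)` are internal non-root vertices of `T`, and each of them comes after
its internal children. -/
structure StarOrder (T : DirTree V) (d : V → ℕ) (t : ℕ → V) (N : ℕ) : Prop where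
  deg : ∀ v, T.deg v = d v
  root : 1 < d T.root
  internal : ∀ i < N, 1 < d (t i)
  ne_root : ∀ i < N, t i ≠ T.root
  notMem : ∀ i < N, t i ∉ initialSeg t i
  child : ∀ i < N, ∀ u ∈ T.children (t i), d u = 1 ∨ u ∈ initialSeg t i

/-- The pendent vertices of the state in which the stars centered in `U` are contracted. -/
def alive (T : DirTree V) (d : V → ℕ) (U : Finset V) : Finset V :=
  Finset.univ.filter fun v => (d v = 1 ∨ v ∈ U) ∧ T.parent v ∉ U

/-- The weights of the vertices in `alive T d U`. -/
def aliveWeights (T : DirTree V) (μ : V → ℝ) (d : V → ℕ) (U : Finset V) : Multiset ℝ :=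
  (alive T d U).val.map (T.f μ)

theorem DirTree.children_eq_empty {T : DirTree V} {d : V → ℕ} (hdeg : ∀ v, T.deg v = d v)
    (hr : 1 < d T.root) {v : V} (hv : d v = 1) : T.children v = ∅ := by
  have h := hdeg v
  have hvr : v ≠ T.root := by rintro rfl; omega
  rw [DirTree.deg, if_neg hvr, hv] at h
  exact Finset.card_eq_zero.1 (by omega)

theorem DirTree.f_eq_of_pendent {T : DirTree V} {d : V → ℕ} (hdeg : ∀ v, T.deg v = d v)
    (hr : 1 < d T.root) (μ : V → ℝ) {v : V} (hv : d v = 1) : T.f μ v = μ v :=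
  DirTree.f_eq_self_of_children_eq_empty μ (DirTree.children_eq_empty hdeg hr hv)

theorem DirTree.card_children {T : DirTree V} {d : V → ℕ} (hdeg : ∀ v, T.deg v = d v)
    {v : V} (hv : v ≠ T.root) : (T.children v).card = d v - 1 := by
  have h := hdeg v
  rw [DirTree.deg, if_neg hv] at h
  omega

namespace StarOrder

variable {T : DirTree V} {d : V → ℕ} {t : ℕ → V} {N : ℕ}

theorem mono (h : StarOrder T d t N) {k : ℕ} (hk : k ≤ N) : StarOrder T d t k where
  deg := h.deg
  root := h.root
  internal i hi := h.internal i (hi.trans_le hk)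
  ne_root i hi := h.ne_root i (hi.trans_le hk)
  notMem i hi := h.notMem i (hi.trans_le hk)
  child i hi := h.child i (hi.trans_le hk)

theorem root_notMem (h : StarOrder T d t N) {i : ℕ} (hi : i ≤ N) : T.root ∉ initialSeg t i := by
  rw [mem_initialSeg]
  rintro ⟨j, hj, h'⟩
  exact h.ne_root j (by omega) h'

theorem closed (h : StarOrder T d t N) {i : ℕ} (hi : i ≤ N) {v : V}
    (hv : T.parent v ∈ initialSeg t i) : d v = 1 ∨ v ∈ initialSeg t i := by
  obtain ⟨j, hj, h'⟩ := mem_initialSeg.1 hv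
  have hne : v ≠ T.root := by
    rintro rfl
    rw [T.parent_root] at hv
    exact h.root_notMem hi hv
  rcases h.child j (by omega) v (DirTree.mem_children_iff.2 ⟨h'.symm, hne⟩) with h1 | h1
  · exact Or.inl h1
  · obtain ⟨k, hk, h2⟩ := mem_initialSeg.1 h1
    exact Or.inr (mem_initialSeg.2 ⟨k, by omega, h2⟩)

theorem parent_notMem (h : StarOrder T d t N) {i : ℕ} (hi : i ≤ N) {v : V} (hv : 1 < d v)
    (hvi : v ∉ initialSeg t i) : T.parent v ∉ initialSeg t i := fun h' => by
  rcases h.closed hi h' with h1 | h1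
  · omega
  · exact hvi h1

theorem aliveWeights_zero (h : StarOrder T d t N) (μ : V → ℝ) :
    aliveWeights T μ d (initialSeg t 0) = pendentWeights μ d := by
  have h1 : alive T d (initialSeg t 0) = Finset.univ.filter fun v => d v = 1 := by
    ext v; simp [alive, initialSeg]
  rw [aliveWeights, h1, pendentWeights]
  refine Multiset.map_congr rfl fun v hv => ?_
  exact DirTree.f_eq_of_pendent h.deg h.root μ (by simpa using hv)

theorem children_subset (h : StarOrder T d t N) {i : ℕ} (hi : i < N) :
    T.children (t i) ⊆ alive T d (initialSeg t i) := by
  intro u hu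
  simp only [alive, Finset.mem_filter, Finset.mem_univ, true_and]
  refine ⟨h.child i hi u hu, ?_⟩
  rw [(DirTree.mem_children.1 hu).1]
  exact h.notMem i hi

theorem aliveWeights_eq_add (h : StarOrder T d t N) (μ : V → ℝ) {i : ℕ} (hi : i < N) :
    aliveWeights T μ d (initialSeg t i) = (T.children (t i)).val.map (T.f μ) +
      (alive T d (initialSeg t i) \ T.children (t i)).val.map (T.f μ) := by
  rw [aliveWeights, ← Multiset.map_add, Finset.sdiff_val,
    add_tsub_cancel_of_le (Finset.val_le_iff.2 (h.children_subset hi))]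

theorem aliveWeights_succ (h : StarOrder T d t N) (μ : V → ℝ) {i : ℕ} (hi : i < N) :
    aliveWeights T μ d (initialSeg t (i + 1)) = T.f μ (t i) ::ₘ
      (alive T d (initialSeg t i) \ T.children (t i)).val.map (T.f μ) := by
  have hn : t i ∉ alive T d (initialSeg t i) \ T.children (t i) := by
    have := h.internal i hi
    have := h.notMem i hi
    simp only [alive, Finset.mem_sdiff, Finset.mem_filter, Finset.mem_univ, true_and]
    rintro ⟨⟨h1 | h1, -⟩, -⟩
    · omega
    · contradiction
  rw [aliveWeights, ← Multiset.map_cons, ← Finset.insert_val_of_notMem hn]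
  congr 2
  ext v
  rw [initialSeg_succ]
  simp only [alive, Finset.mem_insert, Finset.mem_sdiff, Finset.mem_filter, Finset.mem_univ,
    true_and, DirTree.mem_children_iff]
  constructor
  · rintro ⟨h1, h2⟩
    by_cases hv : v = t i
    · exact Or.inl hv
    · exact Or.inr ⟨⟨by tauto, by tauto⟩, by tauto⟩
  · rintro (rfl | ⟨⟨h1, h2⟩, h3⟩)
    · refine ⟨by tauto, ?_⟩
      rintro (h1 | h1)
      · exact T.parent_ne (h.ne_root i hi) h1
      · exact h.parent_notMem hi.le (h.internal i hi) (h.notMem i hi) h1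
    · refine ⟨by tauto, ?_⟩
      rintro (h4 | h4)
      · refine h3 ⟨h4, ?_⟩
        rintro rfl
        rw [T.parent_root] at h4
        exact h.ne_root i hi h4.symm
      · exact h2 h4

theorem centerPairs_eq (h : StarOrder T d t N) (μ : V → ℝ) {i : ℕ} (hi : i < N) :
    centerPairs μ d (initialSeg t i) =
      (μ (t i), d (t i) - 1) ::ₘ centerPairs μ d (initialSeg t (i + 1)) := by
  rw [initialSeg_succ]
  exact centerPairs_eq_cons μ (h.internal i hi) (h.notMem i hi)

theorem card_children (h : StarOrder T d t N) (μ : V → ℝ) {i : ℕ} (hi : i < N) :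
    ((T.children (t i)).val.map (T.f μ)).card = d (t i) - 1 := by
  rw [Multiset.card_map]
  exact DirTree.card_children h.deg (h.ne_root i hi)

/-- The star centered at `t i` is a greedy choice. -/
def IsGreedyAt (T : DirTree V) (μ : V → ℝ) (d : V → ℕ) (t : ℕ → V) (i : ℕ) : Prop :=
  (∀ p ∈ centerPairs μ d (initialSeg t (i + 1)), (μ (t i), d (t i) - 1) ≤ p) ∧
  LeastPart ((T.children (t i)).val.map (T.f μ))
    ((alive T d (initialSeg t i) \ T.children (t i)).val.map (T.f μ))

theorem mergeSeq (h : StarOrder T d t N) (μ : V → ℝ) :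
    MergeSeq (pendentWeights μ d) (centerPairs μ d ∅)
      ((List.range N).map fun i => T.f μ (t i)) := by
  have key : ∀ k i, i + k = N → MergeSeq (aliveWeights T μ d (initialSeg t i))
      (centerPairs μ d (initialSeg t i)) ((List.range' i k).map fun i => T.f μ (t i)) := by
    intro k
    induction k with
    | zero => intro i _; exact .nil _ _
    | succ k ih =>
      intro i hi
      have hi' : i < N := by omega
      have := ih (i + 1) (by omega)
      rw [h.aliveWeights_succ μ hi'] at this
      exact .cons (h.aliveWeights_eq_add μ hi') (h.centerPairs_eq μ hi') (h.card_children μ hi')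
        (DirTree.f_eq_add_sum μ (t i)) this
  have := key N 0 (by omega)
  rw [h.aliveWeights_zero, ← List.range_eq_range'] at this
  exact this

theorem greedySeq (h : StarOrder T d t N) (μ : V → ℝ) (hg : ∀ i < N, IsGreedyAt T μ d t i) :
    GreedySeq (pendentWeights μ d) (centerPairs μ d ∅)
      ((List.range N).map fun i => T.f μ (t i)) := by
  have key : ∀ k i, i + k = N → GreedySeq (aliveWeights T μ d (initialSeg t i))
      (centerPairs μ d (initialSeg t i)) ((List.range' i k).map fun i => T.f μ (t i)) := by
    intro k
    induction k with
    | zero => intro i _; exact .nil _ _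
    | succ k ih =>
      intro i hi
      have hi' : i < N := by omega
      have := ih (i + 1) (by omega)
      rw [h.aliveWeights_succ μ hi'] at this
      refine .cons (h.aliveWeights_eq_add μ hi') (h.centerPairs_eq μ hi') (h.card_children μ hi')
        (DirTree.f_eq_add_sum μ (t i)) ?_ (hg i hi').2 this
      rw [h.centerPairs_eq μ hi']
      intro p hp
      rcases Multiset.mem_cons.1 hp with rfl | hp
      · exact le_rfl
      · exact (hg i hi').1 p hp
  have := key N 0 (by omega)
  rw [h.aliveWeights_zero, ← List.range_eq_range'] at this
  exact this

theorem isGreedyAt (h : StarOrder T d t N) {μ : V → ℝ} (hgen : IsGenTuple μ d)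
    (hmono : DegMonotone μ d)
    (hg : GreedySeq (pendentWeights μ d) (centerPairs μ d ∅)
      ((List.range N).map fun i => T.f μ (t i))) :
    ∀ i < N, IsGreedyAt T μ d t i := by
  have key : ∀ i k, i + k = N →
      Regular (aliveWeights T μ d (initialSeg t i)) (centerPairs μ d (initialSeg t i)) ∧
      GreedySeq (aliveWeights T μ d (initialSeg t i))
      (centerPairs μ d (initialSeg t i)) ((List.range' i k).map fun i => T.f μ (t i)) ∧
      ∀ j < i, IsGreedyAt T μ d t j := by
    intro i
    induction i with
    | zero =>
      intro k hk
      obtain rfl : k = N := by omega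
      rw [h.aliveWeights_zero, ← List.range_eq_range']
      exact ⟨regular_initial hgen hmono, hg, by simp⟩
    | succ i ih =>
      intro k hk
      have hi : i < N := by omega
      obtain ⟨h1, h2, h3⟩ := ih (k + 1) (by omega)
      rw [h.aliveWeights_eq_add μ hi, h.centerPairs_eq μ hi] at h1 h2
      obtain ⟨k1, k2, k3⟩ := h2.step_eq h1 (h.card_children μ hi) (DirTree.f_eq_add_sum μ (t i))
      rw [h.aliveWeights_succ μ hi]
      have h4 := h1.step (h.card_children μ hi)
      refine ⟨?_, k3, fun j hj => ?_⟩
      · convert h4 using 2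
        exact DirTree.f_eq_add_sum μ (t i)
      · rcases Nat.lt_succ_iff_lt_or_eq.1 hj with hj | rfl
        · exact h3 j hj
        · exact ⟨k1, k2⟩
  exact (key N 0 (by omega)).2.2

theorem mem_stateV (h : StarOrder T d t N) {i : ℕ} (hi : i ≤ N) {q : ℕ} {c : Fin q → V}
    (hq : i ≤ q) (hc : ∀ j : Fin q, c j = t j) {v : V} :
    v ∈ stateV T c i ↔ T.parent v ∉ initialSeg t i := by
  simp only [stateV, Finset.mem_sdiff, Finset.mem_univ, true_and, Finset.mem_biUnion,
    Finset.mem_filter, mem_initialSeg, DirTree.mem_children_iff, hc, not_iff_not]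
  constructor
  · rintro ⟨j, hj, h1, -⟩
    exact ⟨j, hj, h1.symm⟩
  · rintro ⟨j, hj, h1⟩
    refine ⟨⟨j, by omega⟩, hj, h1.symm, ?_⟩
    rintro rfl
    rw [T.parent_root] at h1
    exact h.ne_root j (by omega) h1

theorem usedCenters_eq {i q : ℕ} {c : Fin q → V} (hq : i ≤ q) (hc : ∀ j : Fin q, c j = t j) :
    usedCenters c i = initialSeg t i := by
  ext v
  simp only [usedCenters, Finset.mem_image, Finset.mem_filter, Finset.mem_univ, true_and,
    mem_initialSeg, hc]
  constructor
  · rintro ⟨j, hj, h⟩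
    exact ⟨j, hj, h⟩
  · rintro ⟨j, hj, h⟩
    exact ⟨⟨j, by omega⟩, hj, h⟩

theorem isMinimalStar_iff (h : StarOrder T d t N) {μ : V → ℝ}
    (hmono : DegMonotone μ d) {i : ℕ} (hi : i < N) {q : ℕ} {c : Fin q → V}
    (hq : i ≤ q) (hc : ∀ j : Fin q, c j = t j) :
    IsMinimalStar (stateV T c i) (stateMu T μ c i) (stateD d c i) (t i) (T.children (t i)) ↔
      IsGreedyAt T μ d t i := by
  have hV : ∀ v, v ∈ stateV T c i ↔ T.parent v ∉ initialSeg t i :=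
    fun v => h.mem_stateV hi.le hq hc
  have hD : ∀ v, stateD d c i v = if v ∈ initialSeg t i then 1 else d v := fun v => by
    rw [stateD, usedCenters_eq hq hc]
  have hμ : ∀ v, stateMu T μ c i v = if v ∈ initialSeg t i then T.f μ v else μ v := fun v => by
    rw [stateMu, usedCenters_eq hq hc]
  have hD1 : ∀ v, stateD d c i v = 1 ↔ d v = 1 ∨ v ∈ initialSeg t i := fun v => by
    rw [hD]; split_ifs with h <;> simp [h]
  have hD2 : ∀ v, 1 < stateD d c i v ↔ 1 < d v ∧ v ∉ initialSeg t i := fun v => by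
    rw [hD]; split_ifs with h <;> simp [h]
  have hf : ∀ v, stateD d c i v = 1 → stateMu T μ c i v = T.f μ v := fun v hv => by
    rw [hμ]; split_ifs with h1
    · rfl
    · have := (hD1 v).1 hv
      exact (DirTree.f_eq_of_pendent h.deg h.root μ (by tauto)).symm
  have hti := h.notMem i hi
  have hint := h.internal i hi
  have hpair : ∀ p, p ∈ centerPairs μ d (initialSeg t (i + 1)) ↔
      ∃ v, (1 < d v ∧ v ≠ t i ∧ v ∉ initialSeg t i) ∧ (μ v, d v - 1) = p := fun p => by
    simp [centerPairs, initialSeg_succ]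
  constructor
  · rintro ⟨h1, h2, h3, h4, h5, h6, h7, h8, h9⟩
    constructor
    · intro p hp
      obtain ⟨v, ⟨hv, hne, hvi⟩, rfl⟩ := (hpair p).1 hp
      have k1 : v ∈ stateV T c i := (hV v).2 (h.parent_notMem hi.le hv hvi)
      have k2 := h7 v k1 ((hD2 v).2 ⟨hv, hvi⟩)
      have k3 := h8 v k1 ((hD2 v).2 ⟨hv, hvi⟩)
      rw [hμ, hμ, if_neg hti, if_neg hvi] at k2 k3
      rw [hD, hD, if_neg hti, if_neg hvi] at k3
      refine ⟨k2, ?_⟩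
      by_contra hlt
      simp only [not_le] at hlt
      have hlt' : d v < d (t i) := by omega
      have := k3 (le_antisymm (hmono.1 v (t i) hv hint hlt') k2)
      omega
    · intro x hx y hy
      obtain ⟨u, hu, rfl⟩ := Multiset.mem_map.1 hx
      obtain ⟨w, hw, rfl⟩ := Multiset.mem_map.1 hy
      simp only [Finset.mem_val, Finset.mem_sdiff, alive, Finset.mem_filter, Finset.mem_univ,
        true_and] at hu hw
      have k1 := (hD1 w).2 hw.1.1
      rw [← hf u (h6 u hu), ← hf w k1]
      exact h9 u hu w ((hV w).2 hw.1.2) k1 hw.2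
  · rintro ⟨h1, h2⟩
    have hle : ∀ v, 1 < d v → v ∉ initialSeg t i → (μ (t i), d (t i) - 1) ≤ (μ v, d v - 1) := by
      intro v hv hvi
      by_cases hne : v = t i
      · rw [hne]
      · exact h1 _ ((hpair _).2 ⟨v, ⟨hv, hne, hvi⟩, rfl⟩)
    have hL : ∀ v ∈ T.children (t i), stateD d c i v = 1 := fun v hv =>
      (hD1 v).2 (h.child i hi v hv)
    refine ⟨(hV _).2 (h.parent_notMem hi.le hint hti), (hD2 _).2 ⟨hint, hti⟩, ?_, ?_, ?_, hL,
      ?_, ?_, ?_⟩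
    · intro u hu
      rw [hV, (DirTree.mem_children.1 hu).1]
      exact hti
    · intro hu
      exact (DirTree.mem_children.1 hu).2 rfl
    · rw [hD, if_neg hti]
      exact DirTree.card_children h.deg (h.ne_root i hi)
    · intro v hv hv'
      obtain ⟨k1, k2⟩ := (hD2 v).1 hv'
      rw [hμ, hμ, if_neg hti, if_neg k2]
      exact (hle v k1 k2).1
    · intro v hv hv' _
      obtain ⟨k1, k2⟩ := (hD2 v).1 hv'
      rw [hD, hD, if_neg hti, if_neg k2]
      have := (hle v k1 k2).2
      simp only at this
      omega
    · intro u hu w hw hw' hwn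
      rw [hf u (hL u hu), hf w hw']
      refine h2 _ (Multiset.mem_map_of_mem _ hu) _ (Multiset.mem_map_of_mem _ ?_)
      simp only [Finset.mem_val, Finset.mem_sdiff, alive, Finset.mem_filter, Finset.mem_univ,
        true_and]
      exact ⟨⟨(hD1 w).1 hw', (hV w).1 hw⟩, hwn⟩

end StarOrder

theorem DirTree.VWWI_eq_pendent_add {T : DirTree V} {μ : V → ℝ} {d : V → ℕ} (hT : memR T d)
    (hgen : IsGenTuple μ d) :
    VWWI μ T.toGraph = ∑ v ∈ Finset.univ.filter (fun v => d v = 1), μ v * (∑ u, μ u - μ v) +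
      ∑ v ∈ Finset.univ.filter (fun v => 1 < d v ∧ v ≠ T.root),
        T.f μ v * (∑ u, μ u - T.f μ v) := by
  rw [DirTree.VWWI_eq, ← Finset.sum_filter_add_sum_filter_not _ (fun v => d v = 1)]
  congr 1
  · have : (Finset.univ.erase T.root).filter (fun v => d v = 1) =
        Finset.univ.filter fun v => d v = 1 := by
      ext v
      simp only [Finset.mem_filter, Finset.mem_erase, Finset.mem_univ, and_true, true_and,
        and_iff_right_iff_imp]
      rintro hv rfl
      have := hT.1
      omega
    rw [this]
    refine Finset.sum_congr rfl fun v hv => ?_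
    rw [DirTree.f_eq_of_pendent hT.2 hT.1 μ (by simpa using hv)]
  · refine Finset.sum_congr ?_ fun _ _ => rfl
    ext v
    have := hgen.deg_pos v
    simp only [Finset.mem_filter, Finset.mem_erase, Finset.mem_univ, and_true, true_and]
    rw [and_comm]
    refine and_congr_left fun _ => ?_
    omega

theorem StarOrder.sum_initialSeg {T : DirTree V} {d : V → ℕ} {t : ℕ → V} {N : ℕ}
    (h : StarOrder T d t N) (g : V → ℝ) :
    ∑ v ∈ initialSeg t N, g v = ∑ i ∈ Finset.range N, g (t i) := by
  refine Finset.sum_image fun i hi j hj hij => ?_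
  simp only [Finset.coe_range, Set.mem_Iio] at hi hj
  rcases lt_trichotomy i j with hlt | rfl | hlt
  · exact absurd (mem_initialSeg.2 ⟨i, hlt, hij⟩) (h.notMem j hj)
  · rfl
  · exact absurd (mem_initialSeg.2 ⟨j, hlt, hij.symm⟩) (h.notMem i hi)

theorem StarOrder.VWWI_eq {T : DirTree V} {d : V → ℕ} {t : ℕ → V} {N : ℕ}
    (h : StarOrder T d t N) {μ : V → ℝ} (hgen : IsGenTuple μ d)
    (himg : initialSeg t N = Finset.univ.filter fun v => 1 < d v ∧ v ≠ T.root) :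
    VWWI μ T.toGraph = ∑ v ∈ Finset.univ.filter (fun v => d v = 1), μ v * (∑ u, μ u - μ v) +
      ∑ i ∈ Finset.range N, T.f μ (t i) * (∑ u, μ u - T.f μ (t i)) := by
  rw [DirTree.VWWI_eq_pendent_add ⟨h.root, h.deg⟩ hgen, ← himg,
    h.sum_initialSeg fun v => T.f μ v * (∑ u, μ u - T.f μ v)]

/-- The vertices that `par` sends to `v`, other than `v` itself. -/
def kids (par : V → V) (v : V) : Finset V := Finset.univ.filter fun w => par w = v ∧ w ≠ v

theorem mem_kids {par : V → V} {v w : V} : w ∈ kids par v ↔ par w = v ∧ w ≠ v := by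
  simp [kids]

/-- The vertices of a partial forest available as leaves of a new star. -/
def available (d : V → ℕ) (par : V → V) (U : Finset V) : Finset V :=
  Finset.univ.filter fun v => par v = v ∧ (d v = 1 ∨ v ∈ U)

theorem mem_available {d : V → ℕ} {par : V → V} {U : Finset V} {v : V} :
    v ∈ available d par U ↔ par v = v ∧ (d v = 1 ∨ v ∈ U) := by
  simp [available]

/-- `par` is the parent function of a forest whose non-leaf vertices lie in the set `U` of
internal vertices, `ρ` is a rank increasing along the arcs and `wt` gives the weights of the
subordinate groups. -/
structure IsPartialForest (μ : V → ℝ) (d : V → ℕ) (par : V → V) (ρ : V → ℕ) (wt : V → ℝ)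
    (U : Finset V) : Prop where
  parent : ∀ v, par v = v ∨ (par v ∈ U ∧ ρ v < ρ (par v))
  fixed : ∀ v, 1 < d v → v ∉ U → par v = v
  internal : ∀ u ∈ U, 1 < d u
  weight : ∀ v, wt v = μ v + ∑ w ∈ kids par v, wt w

theorem isPartialForest_id (μ : V → ℝ) (d : V → ℕ) : IsPartialForest μ d id 0 μ ∅ where
  parent v := Or.inl rfl
  fixed v _ _ := rfl
  internal := by simp
  weight v := by
    have : kids id v = ∅ := by
      ext w; simp [mem_kids]
    simp [this]

namespace IsPartialForest

variable {μ : V → ℝ} {d : V → ℕ} {par : V → V} {ρ : V → ℕ} {wt : V → ℝ} {U : Finset V}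

theorem kids_eq_empty (h : IsPartialForest μ d par ρ wt U) {v : V} (hv : v ∉ U) :
    kids par v = ∅ := by
  ext w
  simp only [mem_kids, Finset.notMem_empty, iff_false]
  rintro ⟨rfl, hw⟩
  rcases h.parent w with h1 | h1
  · exact hw h1.symm
  · exact hv h1.1

/-- Adding a star with center `c` and set of leaves `A` to a partial forest. -/
theorem attach (h : IsPartialForest μ d par ρ wt U) {c : V} (hc : 1 < d c) (hcU : c ∉ U)
    {A : Finset V} (hA : A ⊆ available d par U) :
    ∃ (ρ' : V → ℕ) (wt' : V → ℝ),
      IsPartialForest μ d (fun v => if v ∈ A then c else par v) ρ' wt' (insert c U) ∧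
      (∀ v, v ≠ c → wt' v = wt v) ∧ wt' c = μ c + ∑ w ∈ A, wt w ∧
      kids (fun v => if v ∈ A then c else par v) c = A ∧
      ∀ v, v ≠ c → kids (fun v => if v ∈ A then c else par v) v = kids par v := by
  have hcA : c ∉ A := fun h' => by
    rcases (mem_available.1 (hA h')).2 with h1 | h1
    · omega
    · exact hcU h1
  have hfix : ∀ v ∈ A, par v = v := fun v hv => (mem_available.1 (hA hv)).1
  have hk1 : kids (fun v => if v ∈ A then c else par v) c = A := by
    ext w
    rw [mem_kids]
    by_cases hw : w ∈ A
    · simp only [hw, if_true, true_and, iff_true]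
      rintro rfl; exact hcA hw
    · simp only [hw, if_false, iff_false]
      intro h'
      have := h.kids_eq_empty hcU
      exact Finset.notMem_empty w (this ▸ mem_kids.2 h')
  have hk2 : ∀ v, v ≠ c → kids (fun v => if v ∈ A then c else par v) v = kids par v := by
    intro v hv
    ext w
    rw [mem_kids, mem_kids]
    by_cases hw : w ∈ A
    · simp only [hw, if_true, hfix w hw]
      constructor
      · rintro ⟨h1, -⟩; exact absurd h1.symm hv
      · rintro ⟨h1, h2⟩; exact absurd h1 h2
    · simp only [hw, if_false]
  refine ⟨Function.update ρ c (Finset.univ.sup ρ + 1),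
    Function.update wt c (μ c + ∑ w ∈ A, wt w), ⟨?_, ?_, ?_, ?_⟩, ?_, ?_, hk1, hk2⟩
  · intro v
    by_cases hv : v ∈ A
    · have hvc : v ≠ c := by rintro rfl; exact hcA hv
      right
      simp only [hv, if_true, Finset.mem_insert_self, Function.update_self, true_and,
        Function.update_of_ne hvc]
      exact Nat.lt_succ_of_le (Finset.le_sup (Finset.mem_univ v))
    · simp only [hv, if_false]
      rcases h.parent v with h1 | h1
      · exact Or.inl h1
      · right
        have h2 : par v ≠ c := by rintro h2; rw [h2] at h1; exact hcU h1.1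
        have h3 : v ≠ c := by rintro rfl; exact h2 (h.fixed _ hc hcU)
        rw [Function.update_of_ne h2, Function.update_of_ne h3]
        exact ⟨Finset.mem_insert_of_mem h1.1, h1.2⟩
  · intro v hv hvU
    rw [Finset.mem_insert, not_or] at hvU
    have hvA : v ∉ A := fun h' => by
      rcases (mem_available.1 (hA h')).2 with h1 | h1
      · omega
      · exact hvU.2 h1
    simp only [hvA, if_false]
    exact h.fixed v hv hvU.2
  · intro u hu
    rcases Finset.mem_insert.1 hu with rfl | hu
    · exact hc
    · exact h.internal u hu
  · intro v
    have hupd : ∀ S : Finset V, c ∉ S →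
        ∑ w ∈ S, Function.update wt c (μ c + ∑ w ∈ A, wt w) w = ∑ w ∈ S, wt w := by
      intro S hS
      refine Finset.sum_congr rfl fun w hw => Function.update_of_ne ?_ _ _
      rintro rfl; exact hS hw
    by_cases hv : v = c
    · subst hv
      rw [hk1, Function.update_self, hupd A hcA]
    · rw [hk2 v hv, Function.update_of_ne hv, hupd, ← h.weight]
      rw [mem_kids, h.fixed c hc hcU]
      rintro ⟨h1, h2⟩
      exact h2 h1
  · intro v hv
    exact Function.update_of_ne hv _ _
  · exact Function.update_self _ _ _

theorem exists_dirTree (h : IsPartialForest μ d par ρ wt U) (hgen : IsGenTuple μ d)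
    (hk : ∀ u ∈ U, (kids par u).card = d u - 1) {l : List ℝ} {P : Multiset ℝ}
    {C : Multiset (ℝ × ℕ)} (hm : MergeSeq P C l) (hP : P = (available d par U).val.map wt)
    (hC : C = centerPairs μ d U) (hcard : C.card = l.length + 1) (g : ℝ → ℝ) :
    ∃ T : DirTree V, memR T d ∧
      ∑ v ∈ Finset.univ.filter (fun v => 1 < d v ∧ v ≠ T.root), g (T.f μ v) =
        ∑ u ∈ U, g (wt u) + (l.map g).sum := by
  induction hm generalizing par ρ wt U with
  | nil =>
    subst hC
    rw [centerPairs, Multiset.card_map, List.length_nil, zero_add] at hcard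
    obtain ⟨r, hr⟩ := Finset.card_eq_one.1 hcard
    have hr' : ∀ v, (1 < d v ∧ v ∉ U) ↔ v = r := fun v => by
      have := Finset.ext_iff.1 hr v
      simpa using this
    obtain ⟨hrd, hrU⟩ := (hr' r).2 rfl
    obtain ⟨ρ', wt', h', hw, -, -, hkids⟩ := h.attach hrd hrU (Finset.Subset.refl _)
    set par' : V → V := fun v => if v ∈ available d par U then r else par v with hpar'
    have hroot : par' r = r := by
      simp only [hpar']
      split_ifs
      · rfl
      · exact h.fixed r hrd hrU
    have hlt : ∀ v, v ≠ r → par' v ≠ v ∧ ρ' v < ρ' (par' v) := by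
      intro v hv
      have hne : par' v ≠ v := by
        simp only [hpar']
        split_ifs with hvA
        · exact hv.symm
        · intro hvp
          rw [mem_available, not_and] at hvA
          have h1 := hvA hvp
          have h2 := hgen.deg_pos v
          push Not at h1
          exact hv ((hr' v).1 ⟨by omega, h1.2⟩)
      exact ⟨hne, ((h'.parent v).resolve_left hne).2⟩
    have hreach : ∀ k v, Finset.univ.sup ρ' - ρ' v = k → ∃ n, par'^[n] v = r := by
      intro k
      induction k using Nat.strong_induction_on with
      | _ k ih =>
        intro v hvk
        by_cases hv : v = r
        · exact ⟨0, hv⟩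
        · have h1 := (hlt v hv).2
          have h2 : ρ' (par' v) ≤ Finset.univ.sup ρ' := Finset.le_sup (Finset.mem_univ _)
          obtain ⟨n, hn⟩ := ih _ (by omega) (par' v) rfl
          exact ⟨n + 1, hn⟩
    let T : DirTree V := ⟨r, par', hroot, fun v => hreach _ v rfl⟩
    have hch : ∀ v, T.children v = kids par' v := fun v => rfl
    have hf : ∀ k v, ρ' v = k → T.f μ v = wt' v := by
      intro k
      induction k using Nat.strong_induction_on with
      | _ k ih =>
        intro v hvk
        rw [DirTree.f_eq_add_sum, h'.weight v, hch]
        congr 1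
        refine Finset.sum_congr rfl fun w hw => ?_
        obtain ⟨h1, h2⟩ := mem_kids.1 hw
        have h3 : ρ' w < ρ' v := by
          rcases h'.parent w with h4 | h4
          · exact absurd (h4.symm.trans h1) h2
          · rw [h1] at h4; exact h4.2
        exact ih _ (hvk ▸ h3) w rfl
    have hU : ∀ v, 1 < d v ∧ v ≠ r ↔ v ∈ U := by
      intro v
      constructor
      · rintro ⟨h1, h2⟩
        by_contra h3
        exact h2 ((hr' v).1 ⟨h1, h3⟩)
      · intro hv
        exact ⟨h.internal v hv, by rintro rfl; exact hrU hv⟩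
    have hdeg : ∀ v, v ≠ r → T.deg v = d v := by
      intro v hv
      have h1 : T.deg v = (kids par v).card + 1 := by
        rw [DirTree.deg, if_neg hv, hch, hkids v hv]
      rw [h1]
      have h2 := hgen.deg_pos v
      by_cases hvU : v ∈ U
      · rw [hk v hvU]; omega
      · rw [h.kids_eq_empty hvU]
        have h3 : ¬ 1 < d v := fun h3 => hvU ((hU v).1 ⟨h3, hv⟩)
        simp; omega
    have hdegr : T.deg r = d r := by
      have h1 := T.sum_deg.trans hgen.sum_deg.symm
      have h2 : T.deg r + ∑ v ∈ Finset.univ.erase r, T.deg v = ∑ v, T.deg v :=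
        Finset.add_sum_erase _ _ (Finset.mem_univ r)
      have h3 : d r + ∑ v ∈ Finset.univ.erase r, d v = ∑ v, d v :=
        Finset.add_sum_erase _ _ (Finset.mem_univ r)
      have h4 : ∑ v ∈ Finset.univ.erase r, T.deg v = ∑ v ∈ Finset.univ.erase r, d v :=
        Finset.sum_congr rfl fun v hv => hdeg v (Finset.ne_of_mem_erase hv)
      omega
    refine ⟨T, ⟨hrd, fun v => ?_⟩, ?_⟩
    · by_cases hv : v = r
      · rw [hv, hdegr]
      · exact hdeg v hv
    · have h1 : Finset.univ.filter (fun v => 1 < d v ∧ v ≠ T.root) = U := by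
        ext v
        simpa using hU v
      rw [h1, List.map_nil, List.sum_nil, add_zero]
      refine Finset.sum_congr rfl fun v hv => ?_
      rw [hf _ v rfl, hw v (by rintro rfl; exact hrU hv)]
  | @cons P A R C C' p z l h1 h2 h3 h4 _ ih =>
    subst hP
    obtain ⟨QA, QR, hQ, rfl, rfl⟩ := Multiset.exists_add_of_map_eq_add h1
    have hp : p ∈ centerPairs μ d U := by rw [← hC, h2]; simp
    obtain ⟨c, hc, rfl⟩ := Multiset.mem_map.1 hp
    obtain ⟨hcd, hcU⟩ : 1 < d c ∧ c ∉ U := by simpa using hc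
    have hC' : C' = centerPairs μ d (insert c U) := by
      rw [hC, centerPairs_eq_cons μ hcd hcU, Multiset.cons_inj_right] at h2
      exact h2.symm
    have hnd : (QA + QR).Nodup := hQ ▸ (available d par U).nodup
    have hdis := (Multiset.nodup_add.1 hnd).2.2
    let A : Finset V := ⟨QA, (Multiset.nodup_add.1 hnd).1⟩
    have hA : A ⊆ available d par U := by
      rw [← Finset.val_le_iff, hQ]
      exact Multiset.le_add_right _ _
    obtain ⟨ρ', wt', h', hw, hwc, hkc, hkids⟩ := h.attach hcd hcU hA
    have hAsum : ∑ w ∈ A, wt w = (QA.map wt).sum := rfl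
    have hz : wt' c = z := by rw [hwc, h4, hAsum]
    have hcQ : c ∉ available d par U := by
      rw [mem_available]
      rintro ⟨-, h5 | h5⟩
      · omega
      · exact hcU h5
    have hcQR : c ∉ QR := fun h5 => hcQ (by
      rw [← Finset.mem_val, hQ]; exact Multiset.mem_add.2 (Or.inr h5))
    have havail : (available d (fun v => if v ∈ A then c else par v) (insert c U)).val =
        c ::ₘ QR := by
      refine (Multiset.Nodup.ext (Finset.nodup _)
        (Multiset.nodup_cons.2 ⟨hcQR, (Multiset.nodup_add.1 hnd).2.1⟩)).2 fun v => ?_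
      have hv : v ∈ available d par U ↔ v ∈ A ∨ v ∈ QR := by
        rw [← Finset.mem_val, hQ, Multiset.mem_add]; rfl
      rw [mem_available] at hv
      rw [Finset.mem_val, mem_available, Multiset.mem_cons, Finset.mem_insert]
      by_cases hvc : v = c
      · subst hvc
        have : v ∉ A := fun h5 => hcQ (hA h5)
        simp [this, h.fixed v hcd hcU]
      · by_cases hvA : v ∈ A
        · have : v ∉ QR := Multiset.disjoint_left.1 hdis hvA
          simp [hvA, hvc, this, Ne.symm hvc]
        · simp only [hvA, if_false, hvc, false_or] at hv ⊢
          exact hv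
    have hk' : ∀ u ∈ insert c U,
        (kids (fun v => if v ∈ A then c else par v) u).card = d u - 1 := by
      intro u hu
      by_cases huc : u = c
      · rw [huc, hkc]
        exact (Multiset.card_map wt QA).symm.trans h3
      · rw [hkids u huc]
        exact hk u ((Finset.mem_insert.1 hu).resolve_left huc)
    have hP' : z ::ₘ QR.map wt =
        (available d (fun v => if v ∈ A then c else par v) (insert c U)).val.map wt' := by
      rw [havail, Multiset.map_cons, hz]
      congr 1
      refine Multiset.map_congr rfl fun v hv => (hw v ?_).symm
      rintro rfl
      exact hcQR hv
    have hcard' : C'.card = l.length + 1 := by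
      rw [h2] at hcard
      simpa using hcard
    obtain ⟨T, hT, hsum⟩ := ih h' hk' hP' hC' hcard'
    have hUsum : ∑ u ∈ U, g (wt' u) = ∑ u ∈ U, g (wt u) :=
      Finset.sum_congr rfl fun u hu => by rw [hw u (by rintro rfl; exact hcU hu)]
    refine ⟨T, hT, ?_⟩
    rw [hsum, Finset.sum_insert hcU, hz, List.map_cons, List.sum_cons, hUsum]
    ring

end IsPartialForest

theorem MergeSeq.exists_dirTree {μ : V → ℝ} {d : V → ℕ} (hgen : IsGenTuple μ d) {l : List ℝ}
    (h : MergeSeq (pendentWeights μ d) (centerPairs μ d ∅) l)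
    (hl : (Finset.univ.filter fun v => 1 < d v).card = l.length + 1) (g : ℝ → ℝ) :
    ∃ T : DirTree V, memR T d ∧
      ∑ v ∈ Finset.univ.filter (fun v => 1 < d v ∧ v ≠ T.root), g (T.f μ v) =
        (l.map g).sum := by
  obtain ⟨T, hT, hsum⟩ := (isPartialForest_id μ d).exists_dirTree hgen (by simp) h
    (by simp [available, pendentWeights]) rfl (by rw [card_centerPairs_empty, hl]) g
  exact ⟨T, hT, by simpa using hsum⟩

theorem card_internal_ne {d : V → ℕ} {r : V} (hr : 1 < d r) :
    (Finset.univ.filter fun v => 1 < d v ∧ v ≠ r).card + 1 =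
      (Finset.univ.filter fun v => 1 < d v).card := by
  have : (Finset.univ.filter fun v => 1 < d v ∧ v ≠ r) =
      (Finset.univ.filter fun v => 1 < d v).erase r := by
    ext v; simp [and_comm]
  rw [this, Finset.card_erase_add_one (by simpa using hr)]

theorem exists_starOrder {T : DirTree V} {μ : V → ℝ} {d : V → ℕ} (hT : memR T d)
    (hgen : IsGenTuple μ d) {N : ℕ}
    (hN : (Finset.univ.filter fun v => 1 < d v).card = N + 1) :
    ∃ t, StarOrder T d t N ∧ (∀ i, i + 1 < N → T.f μ (t i) ≤ T.f μ (t (i + 1))) ∧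
      initialSeg t N = Finset.univ.filter fun v => 1 < d v ∧ v ≠ T.root := by
  set I := Finset.univ.filter fun v => 1 < d v ∧ v ≠ T.root with hI
  have hcard : I.card = N := by
    have : I.card + 1 = _ := card_internal_ne hT.1
    omega
  let r : V → V → Prop := fun u v =>
    T.f μ u < T.f μ v ∨ (T.f μ u = T.f μ v ∧ T.depth v ≤ T.depth u)
  have : Std.Total r := ⟨fun u v => by
    rcases lt_trichotomy (T.f μ u) (T.f μ v) with h | h | h
    · exact Or.inl (Or.inl h)
    · rcases le_total (T.depth u) (T.depth v) with h' | h'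
      · exact Or.inr (Or.inr ⟨h.symm, h'⟩)
      · exact Or.inl (Or.inr ⟨h, h'⟩)
    · exact Or.inr (Or.inl h)⟩
  have : IsTrans V r := ⟨fun u v w h h' => by
    rcases h with h | ⟨h1, h2⟩ <;> rcases h' with h' | ⟨h3, h4⟩
    · exact Or.inl (h.trans h')
    · exact Or.inl (h3 ▸ h)
    · exact Or.inl (h1 ▸ h')
    · exact Or.inr ⟨h1.trans h3, h4.trans h2⟩⟩
  set L := I.toList.insertionSort r with hL
  have hperm : L.Perm I.toList := List.perm_insertionSort r _
  have hlen : L.length = N := by rw [hperm.length_eq, Finset.length_toList, hcard]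
  have hnd : L.Nodup := hperm.nodup_iff.2 I.nodup_toList
  have hmem : ∀ v, v ∈ L ↔ 1 < d v ∧ v ≠ T.root := fun v => by
    rw [hperm.mem_iff, Finset.mem_toList, hI]; simp
  have hsort : L.Pairwise r := List.pairwise_insertionSort r _
  set t : ℕ → V := fun i => L.getD i T.root with ht
  have hti : ∀ i (hi : i < N), t i = L[i]'(hlen ▸ hi) := fun i hi =>
    List.getD_eq_getElem _ _ (hlen ▸ hi)
  have htmem : ∀ i < N, 1 < d (t i) ∧ t i ≠ T.root := fun i hi => by
    rw [← hmem, hti i hi]; exact List.getElem_mem _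
  have hex : ∀ v, 1 < d v → v ≠ T.root → ∃ i < N, t i = v := fun v h1 h2 => by
    obtain ⟨i, hi, h⟩ := List.getElem_of_mem ((hmem v).2 ⟨h1, h2⟩)
    exact ⟨i, hlen ▸ hi, (hti i (hlen ▸ hi)).trans h⟩
  have hr : ∀ i j, i < j → j < N → r (t i) (t j) := fun i j hij hj => by
    rw [hti i (hij.trans hj), hti j hj]
    exact List.pairwise_iff_getElem.1 hsort i j _ _ hij
  refine ⟨t, ⟨hT.2, hT.1, fun i hi => (htmem i hi).1, fun i hi => (htmem i hi).2, ?_, ?_⟩, ?_, ?_⟩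
  · intro i hi hi'
    obtain ⟨j, hj, h⟩ := mem_initialSeg.1 hi'
    rw [hti i hi, hti j (hj.trans hi)] at h
    exact hj.ne ((hnd.getElem_inj_iff).1 h)
  · intro i hi u hu
    rw [or_iff_not_imp_left]
    intro hu1
    obtain ⟨h1, h2⟩ := DirTree.mem_children_iff.1 hu
    have := hgen.deg_pos u
    obtain ⟨j, hj, rfl⟩ := hex u (by omega) h2
    refine mem_initialSeg.2 ⟨j, ?_, rfl⟩
    by_contra hij
    rcases Nat.lt_or_ge i j with hij' | hij'
    · have h3 : T.f μ (t j) ≤ T.f μ (t i) := by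
        rw [← h1]; exact DirTree.f_mono hgen.nonneg (DirTree.desc_parent _)
      have h4 := T.depth_eq_succ h2
      rw [h1] at h4
      rcases hr i j hij' hj with h5 | ⟨-, h5⟩
      · linarith
      · omega
    · obtain rfl : i = j := by omega
      exact (DirTree.mem_children.1 hu).2 rfl
  · intro i hi
    rcases hr i (i + 1) (by omega) hi with h | h
    · exact h.le
    · exact h.1.le
  · ext v
    rw [mem_initialSeg, hI]
    simp only [Finset.mem_filter, Finset.mem_univ, true_and]
    constructor
    · rintro ⟨i, hi, rfl⟩
      exact htmem i hi
    · rintro ⟨h1, h2⟩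
      exact hex v h1 h2

theorem sum_map_range {f : ℕ → ℝ} (n : ℕ) :
    ((List.range n).map f).sum = ∑ i ∈ Finset.range n, f i := by
  induction n with
  | zero => simp
  | succ n ih =>
    rw [List.range_succ, List.map_append, List.sum_append, ih, Finset.sum_range_succ]
    simp

/-- The prefix sums of a greedy sequence are minimal. -/
theorem StarOrder.sum_greedy_le {T : DirTree V} {μ : V → ℝ} {d : V → ℕ} {t : ℕ → V} {N : ℕ}
    (h : StarOrder T d t N) (hgen : IsGenTuple μ d) (hmono : DegMonotone μ d) {x : ℕ → ℝ}
    (hx : GreedySeq (pendentWeights μ d) (centerPairs μ d ∅) ((List.range N).map x)) :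
    ∀ k ≤ N, ∑ i ∈ Finset.range k, x i ≤ ∑ i ∈ Finset.range k, T.f μ (t i) := by
  intro k hk
  have hr := regular_initial hgen hmono
  obtain ⟨l, hl, hsum, hgl⟩ := ((h.mono hk).mergeSeq μ).exists_greedySeq hr
  have hxk := hx.take k
  rw [← List.map_take, List.take_range, min_eq_left hk] at hxk
  have heq := hgl.unique hxk hr (by simpa using hl)
  rwa [heq, sum_map_range, sum_map_range] at hsum

theorem greedy_le_succ {μ : V → ℝ} {d : V → ℕ} {N : ℕ} (hgen : IsGenTuple μ d)
    (hmono : DegMonotone μ d) {x : ℕ → ℝ}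
    (hx : GreedySeq (pendentWeights μ d) (centerPairs μ d ∅) ((List.range N).map x)) :
    ∀ i, i + 1 < N → x i ≤ x (i + 1) := by
  intro i hi
  have h := hx.pairwise_le (regular_initial hgen hmono)
  rw [List.pairwise_iff_getElem] at h
  have h' := h i (i + 1) (by simp; omega) (by simpa using hi) (by omega)
  rwa [List.getElem_map, List.getElem_map, List.getElem_range, List.getElem_range] at h'

theorem two_mul_greedy_le {μ : V → ℝ} {d : V → ℕ} {N : ℕ} (hgen : IsGenTuple μ d)
    (hmono : DegMonotone μ d)
    (hN : (Finset.univ.filter fun v => 1 < d v).card = N + 1) {x : ℕ → ℝ}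
    (hx : GreedySeq (pendentWeights μ d) (centerPairs μ d ∅) ((List.range N).map x)) :
    ∀ i < N, 2 * x i ≤ ∑ v, μ v := by
  intro i hi
  rw [← sum_initial hgen]
  exact hx.two_mul_le (regular_initial hgen hmono) (by rw [card_centerPairs_empty, hN]; simp)
    (card_initial hgen) _ (List.mem_map_of_mem (List.mem_range.2 hi))

theorem DirTree.memT_toGraph {T : DirTree V} {d : V → ℕ} (h : ∀ v, T.deg v = d v) :
    memT T.toGraph d :=
  ⟨DirTree.toGraph_isTree, fun v => (DirTree.gdeg_toGraph v).trans (h v)⟩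

/-- A star sequence of a Huffman tree is a star order with greedy choices. -/
theorem IsHuffmanSeq.exists_starOrder {T : DirTree V} {μ : V → ℝ} {d : V → ℕ}
    (hmono : DegMonotone μ d) {N q : ℕ}
    (hN : (Finset.univ.filter fun v => 1 < d v).card = N + 1) {c : Fin q → V}
    (h : IsHuffmanSeq μ d T c) :
    ∃ t, StarOrder T d t N ∧ (∀ i < N, StarOrder.IsGreedyAt T μ d t i) ∧
      initialSeg t N = Finset.univ.filter fun v => 1 < d v ∧ v ≠ T.root := by
  obtain ⟨hdeg, hinj, hint, hroot, hstar⟩ := h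
  have hq : q = N + 1 := by
    have h1 : (Finset.univ.filter fun v => 1 < d v) = Finset.univ.image c := by
      ext v; simp [hint]
    rw [h1, Finset.card_image_of_injective _ hinj, Finset.card_univ, Fintype.card_fin] at hN
    exact hN
  subst hq
  have hroot' : T.root = c (Fin.last N) := hroot (Nat.succ_pos N)
  let t : ℕ → V := fun i => if hi : i < N + 1 then c ⟨i, hi⟩ else T.root
  have hct : ∀ j : Fin (N + 1), c j = t j := fun j => by simp only [t]; rw [dif_pos j.2]
  have hti : ∀ i (hi : i < N), t i = c ⟨i, by omega⟩ := fun i hi => by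
    simp only [t]; rw [dif_pos]
  have hne : ∀ i < N, t i ≠ T.root := fun i hi h' => by
    rw [hti i hi, hroot'] at h'
    have := congrArg Fin.val (hinj h')
    simp at this; omega
  have hintern : ∀ i < N, 1 < d (t i) := fun i hi => (hint _).2 ⟨_, (hti i hi).symm⟩
  have ho : StarOrder T d t N := by
    refine ⟨hdeg, (hint _).2 ⟨_, hroot'.symm⟩, hintern, hne, ?_, ?_⟩
    · intro i hi hi'
      obtain ⟨j, hj, h'⟩ := mem_initialSeg.1 hi'
      rw [hti i hi, hti j (by omega)] at h'
      have := congrArg Fin.val (hinj h')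
      simp at this; omega
    · intro i hi u hu
      have h1 := hstar ⟨i, by omega⟩ (by simpa using hi)
      have h2 := h1.2.2.2.2.2.1 u (by rw [← hti i hi]; exact hu)
      simp only [stateD, StarOrder.usedCenters_eq (show i ≤ N + 1 by omega) hct] at h2
      split_ifs at h2 with h3
      · exact Or.inr h3
      · exact Or.inl h2
  refine ⟨t, ho, ?_, ?_⟩
  · intro i hi
    have h1 := hstar ⟨i, by omega⟩ (by simpa using hi)
    rw [← hti i hi] at h1
    exact (ho.isMinimalStar_iff hmono hi (by omega) hct).1 h1
  · ext v
    simp only [mem_initialSeg, Finset.mem_filter, Finset.mem_univ, true_and]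
    constructor
    · rintro ⟨i, hi, rfl⟩
      exact ⟨hintern i hi, hne i hi⟩
    · rintro ⟨h1, h2⟩
      obtain ⟨j, rfl⟩ := (hint v).1 h1
      refine ⟨j, ?_, (hct j).symm⟩
      have h3 := j.2
      by_contra h4
      obtain rfl : j = Fin.last N := Fin.ext (by simp; omega)
      exact h2 hroot'.symm

theorem StarOrder.isHuffmanDir {T : DirTree V} {μ : V → ℝ} {d : V → ℕ} {t : ℕ → V} {N : ℕ}
    (h : StarOrder T d t N) (hmono : DegMonotone μ d)
    (hg : ∀ i < N, StarOrder.IsGreedyAt T μ d t i)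
    (himg : initialSeg t N = Finset.univ.filter fun v => 1 < d v ∧ v ≠ T.root) :
    IsHuffmanDir μ d T := by
  let t' : ℕ → V := fun i => if i < N then t i else T.root
  have ht' : ∀ i < N, t' i = t i := fun i hi => if_pos hi
  have hseg : ∀ i ≤ N, initialSeg t' i = initialSeg t i := by
    intro i hi
    refine Finset.image_congr fun j hj => ht' j ?_
    simp at hj; omega
  have h' : StarOrder T d t' N := by
    refine ⟨h.deg, h.root, ?_, ?_, ?_, ?_⟩ <;> intro i hi <;> rw [ht' i hi]
    · exact h.internal i hi
    · exact h.ne_root i hi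
    · rw [hseg i hi.le]; exact h.notMem i hi
    · rw [hseg i hi.le]; exact h.child i hi
  have hroot : t' N = T.root := if_neg (lt_irrefl N)
  refine ⟨N + 1, fun j => t' j, h.deg, ?_, ?_, fun _ => hroot.symm, ?_⟩
  · have key : ∀ i j, i < j → j < N + 1 → t' i ≠ t' j := by
      intro i j hij hj he
      rcases Nat.lt_succ_iff_lt_or_eq.1 hj with hj | rfl
      · exact h'.notMem j hj (mem_initialSeg.2 ⟨i, hij, he⟩)
      · exact h'.ne_root i hij (he.trans hroot)
    intro i j hij
    rcases lt_trichotomy i j with hlt | heq | hlt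
    · exact absurd hij (key i j hlt j.2)
    · exact heq
    · exact absurd hij.symm (key j i hlt i.2)
  · intro v
    have hv : (∃ i < N, t i = v) ↔ 1 < d v ∧ v ≠ T.root := by
      rw [← mem_initialSeg, himg]; simp
    constructor
    · intro h1
      by_cases hvr : v = T.root
      · exact ⟨Fin.last N, by rw [hvr]; exact hroot⟩
      · obtain ⟨i, hi, h2⟩ := hv.2 ⟨h1, hvr⟩
        exact ⟨⟨i, by omega⟩, (ht' i hi).trans h2⟩
    · rintro ⟨j, rfl⟩
      rcases Nat.lt_succ_iff_lt_or_eq.1 j.2 with hj | hj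
      · exact h'.internal j hj
      · simp only [hj, hroot]; exact h.root
  · intro i hi
    have hi' : (i : ℕ) < N := by simpa using hi
    refine (h'.isMinimalStar_iff hmono hi' (by omega) fun _ => rfl).2 ?_
    have := hg i hi'
    rw [StarOrder.IsGreedyAt] at this ⊢
    rw [ht' i hi', hseg i hi'.le, hseg _ hi']
    exact this

/-- For a generating tuple with degree-monotone weights, the minimizers of
the vertex-weighted Wiener index over `𝒯(μ,d)` are exactly the Huffman trees. -/
theorem huffman_minimizes_VWWI {V : Type} [Fintype V] [DecidableEq V]
    (μ : V → ℝ) (d : V → ℕ) (hgen : IsGenTuple μ d) (hmono : DegMonotone μ d) :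
    {G : SimpleGraph V | memT G d ∧ ∀ G' : SimpleGraph V, memT G' d → VWWI μ G ≤ VWWI μ G'} =
    {G : SimpleGraph V | ∃ H : DirTree V, IsHuffmanDir μ d H ∧ H.toGraph = G} := by

  obtain ⟨N, hN⟩ : ∃ N, (Finset.univ.filter fun v => 1 < d v).card = N + 1 :=
    ⟨_, (Nat.sub_add_cancel hgen.one_le_internal).symm⟩
  have hcenter : ∀ (T : DirTree V) (t : ℕ → V), StarOrder T d t N →
      (∀ v, 1 < d v → v ≠ T.root → 2 * T.f μ v ≤ ∑ u, μ u) →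
      ∀ i < N, 2 * T.f μ (t i) ≤ ∑ u, μ u :=
    fun T t h hc i hi => hc _ (h.internal i hi) (h.ne_root i hi)
  ext G
  simp only [Set.mem_ofPred_eq]
  constructor
  · rintro ⟨hG, hmin⟩
    obtain ⟨T, rfl, hT, hc⟩ := DirTree.exists_centroid hgen hG
    obtain ⟨t, ht, hsort, himg⟩ := exists_starOrder hT hgen hN
    refine ⟨T, ?_, rfl⟩
    obtain ⟨l, hl, -, hg⟩ := (ht.mergeSeq μ).exists_greedySeq (regular_initial hgen hmono)
    rw [List.length_map, List.length_range] at hl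
    obtain ⟨x, rfl⟩ : ∃ x : ℕ → ℝ, l = (List.range N).map x :=
      ⟨fun i => l.getD i 0, List.ext_getElem (by simp [hl]) fun i h1 h2 => by simp [h1]⟩
    obtain ⟨T', hT', hsum⟩ := hg.mergeSeq.exists_dirTree hgen (by simpa using hN)
      fun z => z * (∑ u, μ u - z)
    have hle := hmin _ (DirTree.memT_toGraph hT'.2)
    rw [ht.VWWI_eq hgen himg, DirTree.VWWI_eq_pendent_add hT' hgen, hsum, List.map_map,
      sum_map_range] at hle
    have hx := eq_of_sum_mul_sub_le (greedy_le_succ hgen hmono hg) hsort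
      (two_mul_greedy_le hgen hmono hN hg) (hcenter T t ht hc)
      (ht.sum_greedy_le hgen hmono hg) (le_of_add_le_add_left hle)
    rw [List.map_congr_left (g := fun i => T.f μ (t i)) fun i hi => hx i (List.mem_range.1 hi)]
      at hg
    exact ht.isHuffmanDir hmono (ht.isGreedyAt hgen hmono hg) himg
  · rintro ⟨H, ⟨q, c, hH⟩, rfl⟩
    refine ⟨DirTree.memT_toGraph hH.1, fun G' hG' => ?_⟩
    obtain ⟨s, hs, hgs, hsimg⟩ := hH.exists_starOrder hmono hN
    have hg := hs.greedySeq μ hgs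
    obtain ⟨T, rfl, hT, hc⟩ := DirTree.exists_centroid hgen hG'
    obtain ⟨t, ht, hsort, himg⟩ := exists_starOrder hT hgen hN
    rw [ht.VWWI_eq hgen himg, hs.VWWI_eq hgen hsimg]
    exact add_le_add_right (sum_mul_sub_le (greedy_le_succ hgen hmono hg) hsort
      (two_mul_greedy_le hgen hmono hN hg) (hcenter T t ht hc)
      (ht.sum_greedy_le hgen hmono hg)) _
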